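/- arXiv:2105.03130 — 3 statements merged into one kernel-verified Lean document; each statement's English description precedes it below -/
import Mathlib

section
/- Let $(X,\mathcal{B}_X,\mu,T)$ be a $\mathbb{Z}^2$-MPS and $\vec v=(1,\beta)\in\mathbb{R}^2$ a direction vector. Then for any $b_1,b_2\in(0,\infty)$ one has $\mathcal{K}^{\vec v}_\mu(b_1)=\mathcal{K}^{\vec v}_\mu(b_2)$; that is, the $\vec v$-directional Kronecker algebra is independent of the width parameter $b$. -/
open MeasureTheory Filter Set
open scoped ENNReal Topology

namespace Directional

noncomputable section

attribute [local instance] Classical.propDecidable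

variable {X : Type*} [MeasurableSpace X] {G : Type*}

/-- The set of Koopman images `U_T^w 1_B` for `w ∈ Λ`, as elements of `L²(μ)`. -/
def korbit (μ : Measure X) (T : G → X → X) (Λ : Set G) (B : Set X) :
    Set (Lp ℝ 2 μ) :=
  {g | ∃ w ∈ Λ, (g : X → ℝ) =ᵐ[μ] fun x => B.indicator (fun _ => (1 : ℝ)) (T w x)}

/-- A finite measurable partition of `X`. -/
def IsPartition (α : Finset (Set X)) : Prop :=
  (∀ A ∈ α, MeasurableSet A) ∧ ((α : Set (Set X)).PairwiseDisjoint id) ∧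
    ⋃₀ (α : Set (Set X)) = Set.univ

/-- Static entropy `H_μ(α) = -∑ μ(A) log μ(A)`. -/
def partEnt (μ : Measure X) (α : Finset (Set X)) : ℝ :=
  ∑ A ∈ α, Real.negMulLog (μ A).toReal

/-- The join `⋁_{i=1}^k T^{-w_i} α`. -/
def seqJoin (T : G → X → X) (w : ℕ → G) (α : Finset (Set X)) : ℕ → Finset (Set X)
  | 0 => {Set.univ}
  | k + 1 => ((seqJoin T w α k) ×ˢ α).image fun p => p.1 ∩ (T (w k) ⁻¹' p.2)

/-- Sequence entropy `h^S_μ(T, α)` along the sequence `w` for the partition `α`. -/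
def seqEnt (μ : Measure X) (T : G → X → X) (w : ℕ → G) (α : Finset (Set X)) : ℝ :=
  Filter.atTop.limsup fun k : ℕ => partEnt μ (seqJoin T w α k) / (k : ℝ)

/-- Sequence entropy `h^S_μ(T)`, as the supremum over all finite measurable
partitions (valued in `ℝ≥0∞`). -/
def seqEntSup (μ : Measure X) (T : G → X → X) (w : ℕ → G) : ℝ≥0∞ :=
  ⨆ α : {α : Finset (Set X) // IsPartition α}, ENNReal.ofReal (seqEnt μ T w α)

/-- `w : ℕ → G` is an enumeration of an infinite subset of `Λ`. -/
def EnumIn (w : ℕ → G) (Λ : Set G) : Prop :=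
  Function.Injective w ∧ ∀ i, w i ∈ Λ

/-- Conditional entropy `H_μ(α | F)` with respect to a sub-σ-algebra `F`. -/
def condEntAlg (μ : Measure X) (F : MeasurableSpace X) (α : Finset (Set X)) : ℝ :=
  ∑ A ∈ α, ∫ x, Real.negMulLog ((μ[A.indicator (fun _ => (1 : ℝ)) | F]) x) ∂μ

/-- Conditional entropy `H_μ(α | η)` of a partition given another partition. -/
def condEntPart (μ : Measure X) (α η : Finset (Set X)) : ℝ :=
  -∑ A ∈ α, ∑ D ∈ η,
    (μ (A ∩ D)).toReal * Real.log ((μ (A ∩ D)).toReal / (μ D).toReal)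

/-- A `ℤ²`-measure-preserving system: an action of `ℤ²` by homeomorphisms
(continuous maps with continuous inverses `T (-w)`), preserving `μ`. -/
def IsZ2MPS [TopologicalSpace X] (μ : Measure X) (T : ℤ × ℤ → X → X) : Prop :=
  (∀ w, Continuous (T w)) ∧ T 0 = _root_.id ∧ (∀ v w, T (v + w) = T v ∘ T w) ∧
    ∀ w, MeasurePreserving (T w) μ μ

/-- The strip `Λ^{(1,β)}(b) = {(m,n) : βm - b/2 ≤ n ≤ βm + b/2}`. -/
def Lam (β b : ℝ) : Set (ℤ × ℤ) :=
  {p | β * (p.1 : ℝ) - b / 2 ≤ (p.2 : ℝ) ∧ (p.2 : ℝ) ≤ β * (p.1 : ℝ) + b / 2}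

/-- The `(1,β)`-directional Kronecker algebra with width parameter `b`. -/
def dirKron (μ : Measure X) (T : ℤ × ℤ → X → X) (β b : ℝ) : Set (Set X) :=
  {B | MeasurableSet B ∧ IsCompact (closure (korbit μ T (Lam β b) B))}

/-- The directional Kronecker algebra as a σ-algebra (using width `b = 1`,
which is immaterial since `dirKron` is independent of `b`). -/
def dirKronAlg (μ : Measure X) (T : ℤ × ℤ → X → X) (β : ℝ) : MeasurableSpace X :=
  MeasurableSpace.generateFrom (dirKron μ T β 1)

/-- The classical Kronecker algebra of the `ℤ²`-system. -/
def kron (μ : Measure X) (T : ℤ × ℤ → X → X) : Set (Set X) :=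
  {B | MeasurableSet B ∧ IsCompact (closure (korbit μ T Set.univ B))}

/-- `h^{v,*}_μ(α)`: supremum of directional sequence entropies of `α` over all
infinite subsets of the strip (width `1`, immaterial). -/
def hStar (μ : Measure X) (T : ℤ × ℤ → X → X) (β : ℝ) (α : Finset (Set X)) : ℝ :=
  ⨆ w : {w : ℕ → ℤ × ℤ // EnumIn w (Lam β 1)}, seqEnt μ T w.1 α

end
/-- Each strip is covered by finitely many translates of any other strip. -/
theorem exists_finite_translates_Lam (β b c : ℝ) (hb : 0 < b) :
    ∃ F : Set (ℤ × ℤ), F.Finite ∧ ∀ p ∈ Lam β c, ∃ f ∈ F, ∃ l ∈ Lam β b, p = l + f := by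
  set φ : ℤ × ℤ → ℝ := fun p => (p.2 : ℝ) - β * (p.1 : ℝ) with hφ
  have htb : TotallyBounded (φ '' Lam β c) := by
    refine (isCompact_Icc (a := -(c / 2)) (b := c / 2)).totallyBounded.subset ?_
    rintro _ ⟨p, ⟨hp₁, hp₂⟩, rfl⟩
    simp only [hφ, Set.mem_Icc]
    constructor <;> linarith
  obtain ⟨t, hts, htf, ht⟩ :=
    totallyBounded_iff_subset.1 htb _ (Metric.dist_mem_uniformity (half_pos hb))
  obtain ⟨F, -, hF, rfl⟩ := Set.exists_subset_image_finite_and.1 ⟨t, hts, htf, rfl⟩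
  refine ⟨F, hF, fun p hp => ?_⟩
  obtain ⟨_, ⟨f, hf, rfl⟩, hd⟩ := Set.mem_iUnion₂.1 (ht ⟨p, hp, rfl⟩)
  refine ⟨f, hf, p - f, ?_, by simp⟩
  have hd' : |φ p - φ f| < b / 2 := hd
  rw [abs_lt] at hd'
  simp only [hφ] at hd'
  simp only [Lam, Set.mem_ofPred_eq, Prod.fst_sub, Prod.snd_sub, Int.cast_sub]
  constructor <;> linarith [hd'.1, hd'.2]

/-- If `Λ'` is covered by finitely many translates of `Λ`, relative compactness of the orbit
along `Λ` gives relative compactness along `Λ'`. -/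
theorem isCompact_closure_korbit_of_finite_translates
    {X H : Type*} [MeasurableSpace X] [Add H]
    (μ : Measure X) [IsFiniteMeasure μ] (T : H → X → X)
    (hadd : ∀ v w, T (v + w) = T v ∘ T w) (hT : ∀ w, MeasurePreserving (T w) μ μ)
    {Λ Λ' F : Set H} (hF : F.Finite) (hcov : ∀ p ∈ Λ', ∃ f ∈ F, ∃ l ∈ Λ, p = l + f)
    {B : Set X} (hB : MeasurableSet B) (hc : IsCompact (closure (korbit μ T Λ B))) :
    IsCompact (closure (korbit μ T Λ' B)) := by
  refine (hF.isCompact_biUnion fun f _ => hc.image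
    (Lp.isometry_compMeasurePreserving (E := ℝ) (p := 2) (hT f)).continuous).closure_of_subset ?_
  rintro g ⟨p, hp, hg⟩
  obtain ⟨f, hf, l, hl, rfl⟩ := hcov p hp
  have hh := indicatorConstLp_coeFn (p := 2) (hs := (hT l).measurable hB)
    (hμs := measure_ne_top μ _) (c := (1 : ℝ))
  refine Set.mem_iUnion₂.2 ⟨f, hf, _, subset_closure ⟨l, hl, hh⟩, Lp.ext ?_⟩
  refine (Lp.coeFn_compMeasurePreserving _ (hT f)).trans ?_
  refine ((hT f).quasiMeasurePreserving.ae_eq_comp hh).trans (EventuallyEq.symm ?_)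
  rw [hadd] at hg
  exact hg

theorem dirKron_subset_dirKron {X : Type*} [TopologicalSpace X] [MeasurableSpace X]
    (μ : Measure X) [IsFiniteMeasure μ]
    (T : ℤ × ℤ → X → X) (hT : IsZ2MPS μ T) (β b c : ℝ) (hb : 0 < b) :
    dirKron μ T β b ⊆ dirKron μ T β c := by
  obtain ⟨F, hF, hcov⟩ := exists_finite_translates_Lam β b c hb
  exact fun B hB => ⟨hB.1, isCompact_closure_korbit_of_finite_translates μ T hT.2.2.1 hT.2.2.2
    hF hcov hB.1 hB.2⟩

/-- The directional Kronecker algebra is independent of the width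
parameter `b`. -/
theorem dirKron_width_independent
    {X : Type*} [MetricSpace X] [CompactSpace X] [MeasurableSpace X] [BorelSpace X]
    (μ : Measure X) [IsProbabilityMeasure μ] (T : ℤ × ℤ → X → X)
    (hT : IsZ2MPS μ T) (β : ℝ) (b₁ b₂ : ℝ) (hb₁ : 0 < b₁) (hb₂ : 0 < b₂) :
    dirKron μ T β b₁ = dirKron μ T β b₂ :=
  (dirKron_subset_dirKron μ T hT β b₁ b₂ hb₁).antisymm
    (dirKron_subset_dirKron μ T hT β b₂ b₁ hb₂)

end Directional
end

section
/- Let $(X,\mathcal{B}_X,\mu,T)$ be a $\mathbb{Z}^2$-MPS, $\vec v=(1,\beta)\in\mathbb{R}^2$ a direction vector and $b\in(0,\infty)$. For every finite measurable partition $\alpha$ of $X$ and every infinite subset $S'=\{(m'_i,n'_i)\}_{i=1}^\infty$ of $\Lambda^{\vec v}(b)$, one has $h^{S'}_\mu(T,\alpha)\le H_\mu(\alpha\mid\mathcal{K}^{\vec v}_\mu)$. -/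
open MeasureTheory Filter Set
open scoped ENNReal Topology

namespace Directional

noncomputable section

attribute [local instance] Classical.propDecidable

variable {X : Type*} [MeasurableSpace X] {G : Type*}

end

open scoped symmDiff

section TotallyBounded

variable {X : Type*} [MeasurableSpace X] {G : Type*}

/-- For each `ε > 0`, a finite colouring of `Λ` such that translates of `B` along elements of the
same colour are `ε`-close in measure. -/
def HasFiniteColourings (μ : Measure X) (T : G → X → X) (Λ : Set G) (B : Set X) : Prop :=
  ∀ ε : ℝ, 0 < ε → ∃ c : G → ℕ, (c '' Λ).Finite ∧
    ∀ w ∈ Λ, ∀ w' ∈ Λ, c w = c w' → μ.real ((T w ⁻¹' B) ∆ (T w' ⁻¹' B)) ≤ ε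

lemma exists_nat_colouring {κ : Type*} [Countable κ] {Λ : Set G} {P : G → G → Prop}
    (c : G → κ) (hc : (c '' Λ).Finite) (h : ∀ w ∈ Λ, ∀ w' ∈ Λ, c w = c w' → P w w') :
    ∃ c : G → ℕ, (c '' Λ).Finite ∧ ∀ w ∈ Λ, ∀ w' ∈ Λ, c w = c w' → P w w' := by
  obtain ⟨f, hf⟩ := exists_injective_nat κ
  refine ⟨f ∘ c, ?_, fun w hw w' hw' e => h w hw w' hw' (hf e)⟩
  rw [Set.image_comp]
  exact hc.image f

lemma HasFiniteColourings.exists_simultaneous {μ : Measure X} {T : G → X → X} {Λ : Set G}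
    {κ : Type*} [Finite κ] {B : κ → Set X} (h : ∀ v, HasFiniteColourings μ T Λ (B v))
    {ε : ℝ} (hε : 0 < ε) :
    ∃ c : G → ℕ, (c '' Λ).Finite ∧ ∀ w ∈ Λ, ∀ w' ∈ Λ, c w = c w' →
      ∀ v, μ.real ((T w ⁻¹' B v) ∆ (T w' ⁻¹' B v)) ≤ ε := by
  choose c hc hcB using fun v => h v ε hε
  refine exists_nat_colouring (fun w v => c v w) ?_
    fun w hw w' hw' e v => hcB v w hw w' hw' (congrFun e v)
  refine (Set.Finite.pi' hc).subset ?_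
  rintro _ ⟨w, hw, rfl⟩ v
  exact ⟨w, hw, rfl⟩

lemma HasFiniteColourings.iUnion {μ : Measure X} [IsFiniteMeasure μ] {T : G → X → X} {Λ : Set G}
    (hT : ∀ w, MeasurePreserving (T w) μ μ) {B : ℕ → Set X} (hB : ∀ n, MeasurableSet (B n))
    (h : ∀ n, HasFiniteColourings μ T Λ (B n)) : HasFiniteColourings μ T Λ (⋃ n, B n) := by
  intro ε hε
  have hlim : Tendsto (fun n => μ.real (Set.accumulate B n)) atTop (𝓝 (μ.real (⋃ n, B n))) :=
    (ENNReal.tendsto_toReal (measure_ne_top _ _)).comp tendsto_measure_iUnion_accumulate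
  obtain ⟨n, hn⟩ :=
    (hlim.eventually (lt_mem_nhds (sub_lt_self _ (by positivity : 0 < ε / 4)))).exists
  have hacc : MeasurableSet (Set.accumulate B n) := by
    rw [Set.accumulate_def]
    exact MeasurableSet.biUnion (Set.to_countable _) fun i _ => hB i
  have htail : μ.real ((⋃ n, B n) \ Set.accumulate B n) ≤ ε / 4 := by
    rw [measureReal_sdiff (Set.accumulate_subset_iUnion _) hacc]
    linarith
  have htailm : MeasurableSet ((⋃ n, B n) \ Set.accumulate B n) :=
    (MeasurableSet.iUnion hB).diff hacc
  obtain ⟨c, hc, hcB⟩ := HasFiniteColourings.exists_simultaneous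
    (fun v : Fin (n + 1) => h v) (ε := ε / (2 * (n + 1))) (by positivity)
  refine ⟨c, hc, fun w hw w' hw' e => ?_⟩
  have hsub : (T w ⁻¹' ⋃ n, B n) ∆ (T w' ⁻¹' ⋃ n, B n) ⊆
      (T w ⁻¹' ((⋃ n, B n) \ Set.accumulate B n) ∪ T w' ⁻¹' ((⋃ n, B n) \ Set.accumulate B n)) ∪
        ⋃ v : Fin (n + 1), (T w ⁻¹' B v) ∆ (T w' ⁻¹' B v) := by
    have key : ∀ u u' x, T u x ∈ (⋃ n, B n) → T u' x ∉ (⋃ n, B n) →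
        T u x ∈ (⋃ n, B n) \ Set.accumulate B n ∨ ∃ v : Fin (n + 1), T u x ∈ B v ∧ T u' x ∉ B v := by
      intro u u' x h1 h2
      by_cases h3 : T u x ∈ Set.accumulate B n
      · right
        obtain ⟨i, hi, hx⟩ := Set.mem_accumulate.1 h3
        exact ⟨⟨i, by omega⟩, hx, fun hx' => h2 (Set.mem_iUnion.2 ⟨i, hx'⟩)⟩
      · exact Or.inl ⟨h1, h3⟩
    rintro x (⟨h1, h2⟩ | ⟨h1, h2⟩)
    · rcases key w w' x h1 h2 with h | ⟨v, hv⟩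
      · exact Or.inl (Or.inl h)
      · exact Or.inr (Set.mem_iUnion.2 ⟨v, Or.inl hv⟩)
    · rcases key w' w x h1 h2 with h | ⟨v, hv⟩
      · exact Or.inl (Or.inr h)
      · exact Or.inr (Set.mem_iUnion.2 ⟨v, Or.inr hv⟩)
  have h1 := measureReal_mono (μ := μ) hsub
  have h2 := measureReal_union_le (μ := μ)
    (T w ⁻¹' ((⋃ n, B n) \ Set.accumulate B n) ∪ T w' ⁻¹' ((⋃ n, B n) \ Set.accumulate B n))
    (⋃ v : Fin (n + 1), (T w ⁻¹' B v) ∆ (T w' ⁻¹' B v))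
  have h3 := measureReal_union_le (μ := μ) (T w ⁻¹' ((⋃ n, B n) \ Set.accumulate B n))
    (T w' ⁻¹' ((⋃ n, B n) \ Set.accumulate B n))
  rw [(hT w).measureReal_preimage htailm.nullMeasurableSet,
    (hT w').measureReal_preimage htailm.nullMeasurableSet] at h3
  have h4 : μ.real (⋃ v : Fin (n + 1), (T w ⁻¹' B v) ∆ (T w' ⁻¹' B v)) ≤ ε / 2 := by
    refine (measureReal_iUnion_fintype_le _).trans
      ((Finset.sum_le_sum fun v _ => hcB w hw w' hw' e v).trans_eq ?_)
    simp only [Finset.sum_const, Finset.card_univ, Fintype.card_fin, nsmul_eq_mul]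
    push_cast
    field_simp
  linarith

lemma HasFiniteColourings.of_generateFrom {μ : Measure X} [IsFiniteMeasure μ] {T : G → X → X}
    {Λ : Set G} (hT : ∀ w, MeasurePreserving (T w) μ μ) {𝒞 : Set (Set X)}
    (h𝒞m : ∀ B ∈ 𝒞, MeasurableSet B) (h𝒞 : ∀ B ∈ 𝒞, HasFiniteColourings μ T Λ B) {B : Set X}
    (hB : MeasurableSet[MeasurableSpace.generateFrom 𝒞] B) : HasFiniteColourings μ T Λ B := by
  have hle : MeasurableSpace.generateFrom 𝒞 ≤ ‹MeasurableSpace X› :=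
    MeasurableSpace.generateFrom_le h𝒞m
  induction B, hB using MeasurableSpace.generateFrom_induction with
  | hC t ht _ => exact h𝒞 t ht
  | empty => exact fun ε hε => ⟨fun _ => 0, (Set.finite_singleton 0).subset (by simp),
      fun w _ w' _ _ => by simpa using hε.le⟩
  | compl t ht ih =>
    intro ε hε
    simpa only [Set.preimage_compl, compl_symmDiff_compl] using ih ε hε
  | iUnion s hs ih => exact HasFiniteColourings.iUnion hT (fun n => hle _ (hs n)) ih

lemma HasFiniteColourings.of_isCompact_korbit {μ : Measure X} [IsFiniteMeasure μ]
    {T : G → X → X} {Λ : Set G} (hT : ∀ w, Measurable (T w)) {B : Set X} (hB : MeasurableSet B)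
    (h : IsCompact (closure (korbit μ T Λ B))) : HasFiniteColourings μ T Λ B := by
  intro ε hε
  have htb := Metric.totallyBounded_iff.1 (h.totallyBounded.subset subset_closure)
    (Real.sqrt ε / 2) (by positivity)
  obtain ⟨t, ht, hcov⟩ := htb
  let e : G → Lp ℝ 2 μ := fun w =>
    indicatorConstLp 2 (hT w hB) (measure_ne_top μ _) (1 : ℝ)
  have he : ∀ w ∈ Λ, ∃ y ∈ t, dist (e w) y < Real.sqrt ε / 2 := by
    intro w hw
    have hmem : e w ∈ korbit μ T Λ B := ⟨w, hw, indicatorConstLp_coeFn⟩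
    simpa using hcov hmem
  choose! y hyt hy using he
  classical
  by_cases hΛ : Λ.Nonempty
  swap
  · rw [Set.not_nonempty_iff_eq_empty] at hΛ
    subst hΛ
    exact ⟨fun _ => 0, by simp, by simp⟩
  obtain ⟨w₀, hw₀⟩ := hΛ
  have hfin : Finite t := ht
  refine exists_nat_colouring
    (fun w => if hw : w ∈ Λ then (⟨y w, hyt w hw⟩ : t) else ⟨y w₀, hyt w₀ hw₀⟩)
    (Set.toFinite _) fun w hw w' hw' hc => ?_
  simp only [hw, hw', dite_true, Subtype.mk.injEq] at hc
  have hd : dist (e w) (e w') ≤ Real.sqrt ε := by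
    have h1 := dist_triangle_right (e w) (e w') (y w)
    have h2 := hy w hw
    have h3 := hy w' hw'
    rw [← hc] at h3
    linarith
  rw [dist_indicatorConstLp_eq_norm, norm_indicatorConstLp two_ne_zero ENNReal.ofNat_ne_top,
    norm_one, one_mul, ENNReal.toReal_ofNat, ← Real.sqrt_eq_rpow] at hd
  exact (Real.sqrt_le_sqrt_iff hε.le).1 hd

lemma HasFiniteColourings.of_Lam_one {μ : Measure X} {T : ℤ × ℤ → X → X}
    (hadd : ∀ v w, T (v + w) = T v ∘ T w) (hT : ∀ w, MeasurePreserving (T w) μ μ) {β : ℝ}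
    {B : Set X} (hB : MeasurableSet B) (h : HasFiniteColourings μ T (Lam β 1) B) (b : ℝ) :
    HasFiniteColourings μ T (Lam β b) B := by
  intro ε hε
  obtain ⟨c, hc, hcB⟩ := h ε hε
  let r : ℤ × ℤ → ℤ × ℤ := fun p => (p.1, round (β * p.1))
  let d : ℤ × ℤ → ℤ := fun p => p.2 - round (β * p.1)
  have hr : ∀ p, r p ∈ Lam β 1 := by
    intro p
    have := abs_le.1 (abs_sub_round (β * p.1))
    constructor <;> simp only [r] <;> linarith
  have hrd : ∀ p, p = r p + (0, d p) := fun p => by ext <;> simp [r, d]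
  refine exists_nat_colouring (fun p => (c (r p), d p)) ?_ fun w hw w' hw' e => ?_
  · refine (hc.prod (Set.finite_Icc (-⌈b / 2 + 1 / 2⌉) ⌈b / 2 + 1 / 2⌉)).subset ?_
    rintro _ ⟨p, hp, rfl⟩
    refine ⟨⟨_, hr p, rfl⟩, ?_⟩
    have h1 := abs_le.1 (abs_sub_round (β * p.1))
    have h2 := Int.le_ceil (b / 2 + 1 / 2)
    obtain ⟨h3, h4⟩ := hp
    constructor <;> rify <;> simp only [d] <;> push_cast <;> linarith
  · obtain ⟨e1, e2⟩ := Prod.mk.inj e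
    have hpre : ∀ p, T p ⁻¹' B = T (0, d p) ⁻¹' (T (r p) ⁻¹' B) := fun p => by
      conv_lhs => rw [hrd p, hadd]
      rfl
    rw [hpre w, hpre w', ← e2, ← Set.preimage_symmDiff,
      (hT _).measureReal_preimage
        (((hT _).measurable hB).symmDiff ((hT _).measurable hB)).nullMeasurableSet]
    exact hcB _ (hr w) _ (hr w') e1

end TotallyBounded

section Entropy

variable {X : Type*} [MeasurableSpace X]

lemma integrable_finite_comp {κ : Type*} [Finite κ] [MeasurableSpace κ] [MeasurableSingletonClass κ]
    {μ : Measure X} [IsFiniteMeasure μ] (h : κ → ℝ) {Y : X → κ} (hY : Measurable Y) :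
    Integrable (fun x => h (Y x)) μ :=
  (Integrable.of_finite (μ := μ.map Y) (f := h)).comp_measurable hY

lemma integral_finite_comp {κ : Type*} [Fintype κ] [MeasurableSpace κ] [MeasurableSingletonClass κ]
    {μ : Measure X} [IsFiniteMeasure μ] (h : κ → ℝ) {Y : X → κ} (hY : Measurable Y) :
    ∫ x, h (Y x) ∂μ = ∑ a, μ.real (Y ⁻¹' {a}) * h a := by
  rw [← integral_map hY.aemeasurable (measurable_of_finite h).aestronglyMeasurable,
    integral_fintype Integrable.of_finite]
  simp [map_measureReal_apply hY (measurableSet_singleton _)]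

/-- Gibbs' inequality. -/
lemma sum_negMulLog_le_sum_mul_neg_log {κ : Type*} [Fintype κ] {p m : κ → ℝ} (hp : ∀ a, 0 ≤ p a)
    (hm : ∀ a, 0 < m a) (hmp : ∑ a, m a ≤ ∑ a, p a) :
    ∑ a, Real.negMulLog (p a) ≤ ∑ a, p a * -Real.log (m a) := by
  have h : ∀ a, Real.negMulLog (p a) ≤ p a * -Real.log (m a) + (m a - p a) := by
    intro a
    rcases (hp a).eq_or_lt with h0 | h0
    · simpa [← h0] using (hm a).le
    · have h1 := mul_le_mul_of_nonneg_left
        (Real.log_le_sub_one_of_pos (div_pos (hm a) h0)) h0.le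
      rw [Real.log_div (hm a).ne' h0.ne', mul_sub, mul_sub, mul_div_cancel₀ _ h0.ne'] at h1
      rw [Real.negMulLog]
      linarith
  refine (Finset.sum_le_sum fun a _ => h a).trans ?_
  rw [Finset.sum_add_distrib, Finset.sum_sub_distrib]
  linarith

/-- The entropy of a finite-valued variable `Y` is bounded by its expected code length under a
family of codes `q v`, selected by a variable with values in `V`, at the price of `log |V|`. -/
lemma sum_negMulLog_le_log_card_add {κ V : Type*} [Fintype κ] [MeasurableSpace κ]
    [MeasurableSingletonClass κ] [Fintype V] [MeasurableSpace V] [MeasurableSingletonClass V]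
    {μ : Measure X} [IsProbabilityMeasure μ] {Y : X → κ} (hY : Measurable Y) {Z : X → V}
    (hZ : Measurable Z) {q : V → κ → ℝ} (hq : ∀ v a, 0 < q v a) (hq1 : ∀ v, ∑ a, q v a = 1) :
    ∑ a, Real.negMulLog (μ.real (Y ⁻¹' {a})) ≤
      Real.log (Fintype.card V) + ∫ x, -Real.log (q (Z x) (Y x)) ∂μ := by
  have : Nonempty X := nonempty_of_isProbabilityMeasure μ
  have : Nonempty V := ‹Nonempty X›.map Z
  have hcard : (0 : ℝ) < Fintype.card V := by exact_mod_cast Fintype.card_pos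
  let m : κ → ℝ := fun a => (∑ v, q v a) / Fintype.card V
  have hm : ∀ a, 0 < m a := fun a =>
    div_pos (Finset.sum_pos (fun v _ => hq v a) Finset.univ_nonempty) hcard
  have hp1 : ∑ a, μ.real (Y ⁻¹' {a}) = 1 := by
    simpa using (integral_finite_comp (μ := μ) (fun _ : κ => (1 : ℝ)) hY).symm
  have hm1 : ∑ a, m a = 1 := by
    rw [← Finset.sum_div, Finset.sum_comm]
    simp [hq1, hcard.ne']
  refine (sum_negMulLog_le_sum_mul_neg_log (fun _ => measureReal_nonneg) hm
    (hm1.trans hp1.symm).le).trans ?_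
  rw [← integral_finite_comp (fun a => -Real.log (m a)) hY]
  have hint : Integrable (fun x => -Real.log (q (Z x) (Y x))) μ :=
    integrable_finite_comp (fun z : V × κ => -Real.log (q z.1 z.2)) (hZ.prodMk hY)
  calc ∫ x, -Real.log (m (Y x)) ∂μ
      ≤ ∫ x, (Real.log (Fintype.card V) + -Real.log (q (Z x) (Y x))) ∂μ := by
        refine integral_mono (integrable_finite_comp (fun a => -Real.log (m a)) hY)
          ((integrable_const _).add hint) fun x => ?_
        have h1 : q (Z x) (Y x) / Fintype.card V ≤ m (Y x) := by
          refine div_le_div_of_nonneg_right ?_ hcard.le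
          exact Finset.single_le_sum (f := fun v => q v (Y x)) (fun v _ => (hq v _).le)
            (Finset.mem_univ _)
        have h2 := Real.log_le_log (div_pos (hq _ _) hcard) h1
        rw [Real.log_div (hq _ _).ne' hcard.ne'] at h2
        simp only
        linarith
    _ = _ := by
        rw [integral_add (integrable_const _) hint]
        simp

lemma sum_negMulLog_pi_le {k : ℕ} {ι V : Type*} [Fintype ι] [MeasurableSpace ι]
    [MeasurableSingletonClass ι] [Fintype V] [MeasurableSpace V] [MeasurableSingletonClass V]
    {μ : Measure X} [IsProbabilityMeasure μ] {Y : X → Fin k → ι} (hY : Measurable Y) {Z : X → V}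
    (hZ : Measurable Z) {q : Fin k → V → ι → ℝ} (hq : ∀ i v a, 0 < q i v a)
    (hq1 : ∀ i v, ∑ a, q i v a = 1) :
    ∑ a, Real.negMulLog (μ.real (Y ⁻¹' {a})) ≤
      Real.log (Fintype.card V) + ∑ i, ∫ x, -Real.log (q i (Z x) (Y x i)) ∂μ := by
  classical
  refine (sum_negMulLog_le_log_card_add hY hZ (q := fun v a => ∏ i, q i v (a i))
    (fun v a => Finset.prod_pos fun i _ => hq i v (a i)) fun v => ?_).trans_eq ?_
  · rw [← Fintype.piFinset_univ, ← Finset.prod_univ_sum]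
    simp [hq1]
  · rw [← integral_finsetSum _ fun i _ =>
      integrable_finite_comp (fun z : V × (Fin k → ι) => -Real.log (q i z.1 (z.2 i)))
        (hZ.prodMk hY)]
    congr 2 with x
    rw [Real.log_prod fun i _ => (hq i _ _).ne', Finset.sum_neg_distrib]

lemma exists_eq_iInter_of_mem_seqJoin {Ω G ι : Type*} (T : G → Ω → Ω) (w : ℕ → G)
    {α : Finset (Set Ω)} {A : ι → Set Ω} (hA : ∀ B ∈ α, ∃ i, A i = B) (k : ℕ) :
    ∀ J ∈ seqJoin T w α k, ∃ a : Fin k → ι, ⋂ i : Fin k, T (w i) ⁻¹' A (a i) = J := by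
  induction k with
  | zero => simp [seqJoin]
  | succ k ih =>
    intro J hJ
    simp only [seqJoin, Finset.mem_image, Finset.mem_product] at hJ
    obtain ⟨⟨J', B⟩, ⟨hJ', hB⟩, rfl⟩ := hJ
    obtain ⟨a, rfl⟩ := ih J' hJ'
    obtain ⟨j, rfl⟩ := hA B hB
    refine ⟨Fin.snoc a j, ?_⟩
    ext x
    simp [Fin.forall_fin_succ']

lemma partEnt_seqJoin_le {G ι : Type*} [Fintype ι] {μ : Measure X} [IsProbabilityMeasure μ]
    (T : G → X → X) (w : ℕ → G) {α : Finset (Set X)} {A : ι → Set X}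
    (hA : ∀ B ∈ α, ∃ i, A i = B) (k : ℕ) :
    partEnt μ (seqJoin T w α k) ≤
      ∑ a : Fin k → ι, Real.negMulLog (μ.real (⋂ i : Fin k, T (w i) ⁻¹' A (a i))) := by
  classical
  have hnn : ∀ B : Set X, 0 ≤ Real.negMulLog (μ.real B) := fun B =>
    Real.negMulLog_nonneg measureReal_nonneg measureReal_le_one
  have hsub : seqJoin T w α k ⊆
      Finset.univ.image fun a : Fin k → ι => ⋂ i : Fin k, T (w i) ⁻¹' A (a i) := fun J hJ => by
    simpa using exists_eq_iInter_of_mem_seqJoin T w hA k J hJ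
  exact (Finset.sum_le_sum_of_subset_of_nonneg hsub fun B _ _ => hnn B).trans
    (Finset.sum_image_le_of_nonneg fun B _ => hnn B)

lemma abs_negMulLog_le_one {x : ℝ} (h0 : 0 ≤ x) (h1 : x ≤ 1) : |Real.negMulLog x| ≤ 1 := by
  rw [abs_of_nonneg (Real.negMulLog_nonneg h0 h1)]
  rcases h0.eq_or_lt with rfl | h0
  · simp
  · have h := mul_le_mul_of_nonneg_left (Real.one_sub_inv_le_log_of_pos h0) h0.le
    rw [mul_sub, mul_inv_cancel₀ h0.ne'] at h
    rw [Real.negMulLog]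
    linarith

/-- The conditional distribution of `φ` given `F` is approximated by a positive `F`-measurable
finite-valued one, whose expected code length almost attains the conditional entropy. -/
lemma exists_finite_code {Ω ι : Type*} {F : MeasurableSpace Ω} [mΩ : MeasurableSpace Ω]
    [Fintype ι] [MeasurableSpace ι] [MeasurableSingletonClass ι] {μ : Measure Ω}
    [IsProbabilityMeasure μ] (hF : F ≤ mΩ) {φ : Ω → ι} (hφ : Measurable φ) {ε : ℝ} (hε : 0 < ε) :
    ∃ (N : ℕ) (s : Ω → ι → Fin (N + 1)) (Q : (ι → Fin (N + 1)) → ι → ℝ), Measurable[F] s ∧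
      (∀ v a, 0 < Q v a) ∧ (∀ v, ∑ a, Q v a = 1) ∧
      ∫ x, -Real.log (Q (s x) (φ x)) ∂μ ≤
        ∑ a, ∫ x, Real.negMulLog ((μ[(φ ⁻¹' {a}).indicator (fun _ => (1 : ℝ)) | F]) x) ∂μ + ε := by
  have : Nonempty Ω := nonempty_of_isProbabilityMeasure μ
  have : Nonempty ι := ‹Nonempty Ω›.map φ
  let g : ι → Ω → ℝ := fun a => (φ ⁻¹' {a}).indicator (fun _ => (1 : ℝ))
  let f : ι → Ω → ℝ := fun a => μ[g a | F]
  change ∃ N s Q, _ ∧ _ ∧ _ ∧ _ ≤ ∑ a, ∫ x, Real.negMulLog (f a x) ∂μ + ε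
  obtain ⟨N, hN⟩ := exists_nat_gt (Fintype.card ι / ε)
  have hN0 : (0 : ℝ) < N := lt_of_le_of_lt (by positivity) hN
  have hg : ∀ a, Integrable (g a) μ := fun a =>
    (integrable_const _).indicator (hφ (measurableSet_singleton a))
  have hg1 : ∑ a, g a = fun _ => 1 := by
    classical
    ext x
    simp [g, Set.indicator_apply]
  have hf0 : ∀ᵐ x ∂μ, ∀ a, 0 ≤ f a x := ae_all_iff.2 fun a =>
    condExp_nonneg (.of_forall fun x => Set.indicator_nonneg (fun _ _ => zero_le_one) x)
  have hf1 : ∀ᵐ x ∂μ, ∑ a, f a x = 1 := by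
    have h := condExp_finsetSum (μ := μ) (s := Finset.univ) (fun a _ => hg a) F
    rw [hg1, condExp_const hF] at h
    filter_upwards [h] with x hx
    simpa using hx.symm
  have hfle : ∀ᵐ x ∂μ, ∀ a, f a x ≤ 1 := by
    filter_upwards [hf0, hf1] with x h0 h1 a
    rw [← h1]
    exact Finset.single_le_sum (f := fun a => f a x) (fun a _ => h0 a) (Finset.mem_univ a)
  have hfm : ∀ a, Measurable[F] (f a) := fun a => stronglyMeasurable_condExp.measurable
  let s : Ω → ι → Fin (N + 1) := fun x a => ⟨min N ⌊N * f a x⌋₊, by omega⟩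
  let Q : (ι → Fin (N + 1)) → ι → ℝ := fun v a => ((v a : ℕ) + 1 : ℝ) / ∑ b, ((v b : ℕ) + 1 : ℝ)
  have hden : ∀ v : ι → Fin (N + 1), (0 : ℝ) < ∑ b, ((v b : ℕ) + 1 : ℝ) := fun v =>
    Finset.sum_pos (fun b _ => by positivity) Finset.univ_nonempty
  have hQ : ∀ v a, 0 < Q v a := fun v a => div_pos (by positivity) (hden v)
  have hs : Measurable[F] s := by
    refine @measurable_pi_lambda _ _ _ F _ _ fun a => ?_
    have h1 : Measurable[F] fun x => ⌊N * f a x⌋₊ :=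
      Nat.measurable_floor.comp ((hfm a).const_mul (N : ℝ))
    exact (measurable_from_top (f := fun n : ℕ => (⟨min N n, by omega⟩ : Fin (N + 1)))).comp h1
  have hsm : Measurable s := hs.mono hF le_rfl
  refine ⟨N, s, Q, hs, hQ, fun v => ?_, ?_⟩
  · rw [← Finset.sum_div, div_self (hden v).ne']
  let L : ℝ := Real.log (1 + Fintype.card ι / N)
  have hL : L ≤ ε := by
    have h1 := Real.log_le_sub_one_of_pos (x := 1 + Fintype.card ι / N) (by positivity)
    have h2 : Fintype.card ι / (N : ℝ) ≤ ε := by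
      rw [div_lt_iff₀ hε] at hN
      rw [div_le_iff₀ hN0]
      linarith
    simp only [L]
    linarith
  have hh : ∀ a, Integrable (fun x => -Real.log (Q (s x) a)) μ := fun a =>
    integrable_finite_comp (fun v => -Real.log (Q v a)) hsm
  have hhg : ∀ a, Integrable ((fun x => -Real.log (Q (s x) a)) * g a) μ := fun a => by
    have : ((fun x => -Real.log (Q (s x) a)) * g a) =
        (φ ⁻¹' {a}).indicator fun x => -Real.log (Q (s x) a) := by
      ext x
      by_cases hx : x ∈ φ ⁻¹' {a} <;> simp [g, hx]
    rw [this]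
    exact (hh a).indicator (hφ (measurableSet_singleton a))
  have hpull : ∀ a, μ[(fun x => -Real.log (Q (s x) a)) * g a | F] =ᵐ[μ]
      (fun x => -Real.log (Q (s x) a)) * f a := fun a =>
    condExp_mul_of_stronglyMeasurable_left
      (((measurable_of_finite fun v => -Real.log (Q v a)).comp hs).stronglyMeasurable)
      (hhg a) (hg a)
  have hsplit : ∫ x, -Real.log (Q (s x) (φ x)) ∂μ =
      ∑ a, ∫ x, -Real.log (Q (s x) a) * f a x ∂μ := by
    calc ∫ x, -Real.log (Q (s x) (φ x)) ∂μ
        = ∫ x, ∑ a, ((fun x => -Real.log (Q (s x) a)) * g a) x ∂μ := by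
          classical
          congr 1 with x
          simp [g, Set.indicator_apply]
      _ = ∑ a, ∫ x, ((fun x => -Real.log (Q (s x) a)) * g a) x ∂μ :=
          integral_finsetSum _ fun a _ => hhg a
      _ = _ := Finset.sum_congr rfl fun a _ => by
          rw [← integral_condExp hF]
          exact integral_congr_ae (hpull a)
  have hfi : ∀ a, Integrable (f a) μ := fun a => integrable_condExp
  have hnml : ∀ a, Integrable (fun x => Real.negMulLog (f a x)) μ := fun a => by
    refine Integrable.of_bound (C := 1) ?_ ?_
    · exact (Real.continuous_negMulLog.measurable.comp
        ((hfm a).mono hF le_rfl)).aestronglyMeasurable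
    · filter_upwards [hf0, hfle] with x h0 h1
      exact abs_negMulLog_le_one (h0 a) (h1 a)
  have hterm : ∀ a, ∫ x, -Real.log (Q (s x) a) * f a x ∂μ ≤
      ∫ x, Real.negMulLog (f a x) ∂μ + (∫ x, f a x ∂μ) * L := fun a => by
    rw [← integral_mul_const, ← integral_add (hnml a) ((hfi a).mul_const _)]
    refine integral_mono_ae (integrable_condExp.congr (hpull a))
      ((hnml a).add ((hfi a).mul_const _)) ?_
    filter_upwards [hf0, hf1, hfle] with x h0 h1 hle
    have hsx : ∀ b, ((s x b : ℕ) : ℝ) = ⌊N * f b x⌋₊ := fun b => by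
      have : ⌊N * f b x⌋₊ ≤ N := Nat.floor_le_of_le (by nlinarith [hle b])
      simp [s, this]
    rcases (h0 a).eq_or_lt with hz | hpos
    · simp [← hz]
    have hnum : N * f a x ≤ (s x a : ℕ) + 1 := by
      rw [hsx]
      exact (Nat.lt_floor_add_one _).le
    have hsum : ∑ b, ((s x b : ℕ) + 1 : ℝ) ≤ N + Fintype.card ι := by
      calc ∑ b, ((s x b : ℕ) + 1 : ℝ) ≤ ∑ b, (N * f b x + 1) := by
            refine Finset.sum_le_sum fun b _ => ?_
            rw [hsx]
            linarith [Nat.floor_le (mul_nonneg hN0.le (h0 b))]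
        _ = N + Fintype.card ι := by
            rw [Finset.sum_add_distrib, ← Finset.mul_sum, h1]
            simp
    have hQle : f a x / (1 + Fintype.card ι / N) ≤ Q (s x) a := by
      have : f a x / (1 + Fintype.card ι / N) = (N * f a x) / (N + Fintype.card ι) := by
        field_simp
      rw [this]
      exact div_le_div₀ (by positivity) hnum (hden _) hsum
    have hlog := Real.log_le_log (by positivity) hQle
    rw [Real.log_div hpos.ne' (by positivity)] at hlog
    have := mul_le_mul_of_nonneg_left hlog hpos.le
    simp only [Real.negMulLog, L]
    linarith
  have hfint : ∑ a, ∫ x, f a x ∂μ = 1 := by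
    rw [← integral_finsetSum _ fun a _ => hfi a, integral_congr_ae hf1]
    simp
  rw [hsplit]
  refine (Finset.sum_le_sum fun a _ => hterm a).trans ?_
  rw [Finset.sum_add_distrib, ← Finset.sum_mul, hfint]
  linarith

end Entropy

lemma integral_comp_le_add_measureReal_ne {X ι V : Type*} [MeasurableSpace X] [Finite ι]
    [MeasurableSpace ι] [MeasurableSingletonClass ι] [Fintype V] [MeasurableSpace V]
    [MeasurableSingletonClass V] {μ : Measure X} [IsFiniteMeasure μ] {Y : X → ι}
    (hY : Measurable Y) {Z Z' : X → V} (hZ : Measurable Z) (hZ' : Measurable Z') {h : V → ι → ℝ}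
    {M : ℝ} (hM : ∀ v a, |h v a| ≤ M) :
    ∫ x, h (Z' x) (Y x) ∂μ ≤ ∫ x, h (Z x) (Y x) ∂μ +
      2 * M * ∑ v, μ.real ((Z ⁻¹' {v}) ∆ (Z' ⁻¹' {v})) := by
  have hD : ∀ v, MeasurableSet ((Z ⁻¹' {v}) ∆ (Z' ⁻¹' {v})) := fun v =>
    (hZ (measurableSet_singleton v)).symmDiff (hZ' (measurableSet_singleton v))
  have hint : ∀ {W : X → V}, Measurable W → Integrable (fun x => h (W x) (Y x)) μ := fun hW =>
    integrable_finite_comp (fun z : V × ι => h z.1 z.2) (hW.prodMk hY)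
  have hind : ∀ v, Integrable (((Z ⁻¹' {v}) ∆ (Z' ⁻¹' {v})).indicator fun _ => (1 : ℝ)) μ :=
    fun v => (integrable_const _).indicator (hD v)
  have hsum : ∑ v, μ.real ((Z ⁻¹' {v}) ∆ (Z' ⁻¹' {v})) =
      ∫ x, ∑ v, ((Z ⁻¹' {v}) ∆ (Z' ⁻¹' {v})).indicator (fun _ => (1 : ℝ)) x ∂μ := by
    rw [integral_finsetSum _ fun v _ => hind v]
    simp [integral_indicator, hD]
  rw [hsum, ← integral_const_mul, ← integral_add (hint hZ)
    ((integrable_finsetSum _ fun v _ => hind v).const_mul _)]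
  refine integral_mono (hint hZ')
    ((hint hZ).add ((integrable_finsetSum _ fun v _ => hind v).const_mul _)) fun x => ?_
  have hM0 : 0 ≤ M := (abs_nonneg _).trans (hM (Z x) (Y x))
  have hnn : ∀ v, 0 ≤ ((Z ⁻¹' {v}) ∆ (Z' ⁻¹' {v})).indicator (fun _ => (1 : ℝ)) x := fun v =>
    Set.indicator_nonneg (fun _ _ => zero_le_one) x
  simp only
  by_cases hx : Z x = Z' x
  · rw [hx, le_add_iff_nonneg_right]
    exact mul_nonneg (by positivity) (Finset.sum_nonneg fun v _ => hnn v)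
  · have h1 : 1 ≤ ∑ v, ((Z ⁻¹' {v}) ∆ (Z' ⁻¹' {v})).indicator (fun _ => (1 : ℝ)) x := by
      refine le_trans (le_of_eq ?_)
        (Finset.single_le_sum (fun v _ => hnn v) (Finset.mem_univ (Z x)))
      rw [Set.indicator_of_mem]
      exact Or.inl ⟨rfl, fun e => hx (Eq.symm e)⟩
    have h2 := (abs_le.1 (hM (Z x) (Y x))).1
    have h3 := (abs_le.1 (hM (Z' x) (Y x))).2
    nlinarith

lemma seqEnt_le_of_forall_le {X G : Type*} [MeasurableSpace X] {μ : Measure X}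
    [IsProbabilityMeasure μ] {T : G → X → X} {w : ℕ → G} {α : Finset (Set X)} {L H : ℝ}
    (h : ∀ k : ℕ, partEnt μ (seqJoin T w α k) ≤ L + k * H) : seqEnt μ T w α ≤ H := by
  refine le_of_forall_pos_le_add fun ε hε => ?_
  have hnn : ∀ k : ℕ, 0 ≤ partEnt μ (seqJoin T w α k) / (k : ℝ) := fun k =>
    div_nonneg (Finset.sum_nonneg fun B _ =>
      Real.negMulLog_nonneg measureReal_nonneg measureReal_le_one) k.cast_nonneg
  refine limsup_le_of_le (isCoboundedUnder_le_of_le _ hnn) ?_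
  have hlim : Tendsto (fun k : ℕ => L / (k : ℝ)) atTop (𝓝 0) :=
    tendsto_const_div_atTop_nhds_zero_nat L
  filter_upwards [hlim.eventually (gt_mem_nhds hε), eventually_gt_atTop 0] with k hk hk0
  have hk0' : (0 : ℝ) < k := by exact_mod_cast hk0
  calc partEnt μ (seqJoin T w α k) / (k : ℝ) ≤ (L + k * H) / k :=
        div_le_div_of_nonneg_right (h k) hk0'.le
    _ = L / k + H := by field_simp
    _ ≤ H + ε := by linarith

/-- Sequence entropy along `Λ` is bounded by the conditional entropy given any sub-σ-algebra
consisting of sets whose translates along `Λ` are totally bounded. -/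
lemma seqEnt_le_condEntAlg {X G : Type*} {F : MeasurableSpace X} [mX : MeasurableSpace X]
    {μ : Measure X} [IsProbabilityMeasure μ] {T : G → X → X}
    (hT : ∀ w, MeasurePreserving (T w) μ μ) (hF : F ≤ mX) {Λ : Set G}
    (hFΛ : ∀ B, MeasurableSet[F] B → HasFiniteColourings μ T Λ B)
    {α : Finset (Set X)} (hα : IsPartition α) {w : ℕ → G} (hw : ∀ i, w i ∈ Λ) :
    seqEnt μ T w α ≤ condEntAlg μ F α := by
  obtain ⟨hαm, hαd, hαu⟩ := hα
  let A : Fin α.card → Set X := fun i => (α.equivFin.symm i : Set X)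
  have hAα : ∀ i, A i ∈ α := fun i => (α.equivFin.symm i).2
  have hA : ∀ B ∈ α, ∃ i, A i = B := fun B hB => ⟨α.equivFin ⟨B, hB⟩, by simp [A]⟩
  have hAinj : ∀ i j, A i = A j → i = j := fun i j e =>
    α.equivFin.symm.injective (Subtype.ext e)
  have hcover : ∀ x, ∃ i, x ∈ A i := fun x => by
    obtain ⟨B, hB, hx⟩ := Set.mem_sUnion.1 (hαu.symm ▸ Set.mem_univ x)
    obtain ⟨i, rfl⟩ := hA B hB
    exact ⟨i, hx⟩
  choose φ hφmem using hcover
  have hφA : ∀ i, φ ⁻¹' {i} = A i := fun i => by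
    ext x
    refine ⟨fun h => h ▸ hφmem x, fun h => hAinj _ _ ?_⟩
    by_contra hne
    exact Set.disjoint_left.1 (hαd (hAα (φ x)) (hAα i) hne) (hφmem x) h
  have hφ : Measurable φ := measurable_to_countable' fun i => by
    rw [hφA]
    exact hαm _ (hAα i)
  have hcond : condEntAlg μ F α =
      ∑ i, ∫ x, Real.negMulLog ((μ[(φ ⁻¹' {i}).indicator (fun _ => (1 : ℝ)) | F]) x) ∂μ := by
    rw [condEntAlg, ← Finset.sum_coe_sort]
    simp only [hφA]
    exact (Equiv.sum_comp α.equivFin.symm fun B : α =>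
      ∫ x, Real.negMulLog ((μ[(B : Set X).indicator (fun _ => (1 : ℝ)) | F]) x) ∂μ).symm
  refine le_of_forall_pos_le_add fun ε hε => ?_
  obtain ⟨N, s, Q, hs, hQ, hQ1, hQH⟩ := exists_finite_code (μ := μ) hF hφ (half_pos hε)
  rw [← hcond] at hQH
  have hsm : Measurable s := hs.mono hF le_rfl
  let V := Fin α.card → Fin (N + 1)
  let M : ℝ := ∑ v : V, ∑ a, |-Real.log (Q v a)|
  have hM : ∀ v a, |-Real.log (Q v a)| ≤ M := fun v a =>
    (Finset.single_le_sum (f := fun a => |-Real.log (Q v a)|) (fun _ _ => abs_nonneg _)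
      (Finset.mem_univ a)).trans
    (Finset.single_le_sum (f := fun v => ∑ a, |-Real.log (Q v a)|)
      (fun _ _ => Finset.sum_nonneg fun _ _ => abs_nonneg _) (Finset.mem_univ v))
  have hM0 : 0 ≤ M := Finset.sum_nonneg fun _ _ => Finset.sum_nonneg fun _ _ => abs_nonneg _
  have hV : (0 : ℝ) < Fintype.card V := by exact_mod_cast Fintype.card_pos
  obtain ⟨c, hc, hcB⟩ := HasFiniteColourings.exists_simultaneous
    (fun v : V => hFΛ _ (hs (measurableSet_singleton v)))
    (ε := ε / (2 * (2 * M + 1) * Fintype.card V)) (by positivity)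
  have : Nonempty G := ⟨w 0⟩
  have hrep : ∀ n ∈ c '' Λ, ∃ u ∈ Λ, c u = n := fun n hn => hn
  choose! u huΛ hcu using hrep
  have : Fintype (c '' Λ) := hc.fintype
  let Z : X → (c '' Λ) → V := fun x j => s (T (u j) x)
  have hZ : Measurable Z :=
    measurable_pi_lambda _ fun j => hsm.comp (hT (u j)).measurable
  have hcode : ∀ i, ∫ x, -Real.log (Q (s (T (u (c (w i))) x)) (φ (T (w i) x))) ∂μ ≤
      condEntAlg μ F α + ε := by
    intro i
    have hmem : c (w i) ∈ c '' Λ := ⟨w i, hw i, rfl⟩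
    have h1 := integral_comp_le_add_measureReal_ne (μ := μ) (hφ.comp (hT (w i)).measurable)
      (hsm.comp (hT (w i)).measurable) (hsm.comp (hT (u (c (w i)))).measurable)
      (h := fun v a => -Real.log (Q v a)) hM
    have h2 : ∫ x, -Real.log (Q (s (T (w i) x)) (φ (T (w i) x))) ∂μ =
        ∫ x, -Real.log (Q (s x) (φ x)) ∂μ := by
      rw [← integral_map (hT (w i)).measurable.aemeasurable
        (f := fun x => -Real.log (Q (s x) (φ x))), (hT (w i)).map_eq]
      exact ((measurable_of_finite fun z : V × Fin α.card => -Real.log (Q z.1 z.2)).comp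
        (hsm.prodMk hφ)).aestronglyMeasurable
    have h3 : ∑ v : V, μ.real (((s ∘ T (w i)) ⁻¹' {v}) ∆ ((s ∘ T (u (c (w i)))) ⁻¹' {v})) ≤
        ε / (2 * (2 * M + 1)) := by
      refine (Finset.sum_le_sum fun v _ =>
        hcB (w i) (hw i) _ (huΛ _ hmem) (hcu _ hmem).symm v).trans_eq ?_
      rw [Finset.sum_const, Finset.card_univ, nsmul_eq_mul]
      field_simp
    have h4 : 2 * M * (ε / (2 * (2 * M + 1))) ≤ ε / 2 := by
      rw [mul_div_assoc', div_le_div_iff₀ (by positivity) (by positivity)]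
      nlinarith
    have h5 := mul_le_mul_of_nonneg_left h3 (by positivity : 0 ≤ 2 * M)
    simp only [Function.comp_apply] at h1
    linarith
  refine seqEnt_le_of_forall_le (L := Real.log (Fintype.card ((c '' Λ) → V))) fun k => ?_
  refine (partEnt_seqJoin_le T w hA k).trans ?_
  have hcell : ∀ a : Fin k → Fin α.card, ⋂ i : Fin k, T (w i) ⁻¹' A (a i) =
      (fun x (i : Fin k) => φ (T (w i) x)) ⁻¹' {a} := fun a => by
    ext x
    simp [← hφA, funext_iff]
  simp only [hcell]
  refine (sum_negMulLog_pi_le (measurable_pi_lambda _ fun i => hφ.comp (hT (w i)).measurable) hZ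
    (q := fun i z a => Q (z ⟨c (w i), w i, hw i, rfl⟩) a) (fun _ _ _ => hQ _ _)
    fun _ _ => hQ1 _).trans ?_
  refine add_le_add_right ((Finset.sum_le_sum fun (i : Fin k) _ => hcode i).trans_eq ?_) _
  simp [mul_add]

/-- directional sequence entropy is bounded by the conditional
entropy with respect to the directional Kronecker algebra. -/
theorem seqEnt_le_condEnt_dirKron
    {X : Type*} [MetricSpace X] [CompactSpace X] [MeasurableSpace X] [BorelSpace X]
    (μ : Measure X) [IsProbabilityMeasure μ] (T : ℤ × ℤ → X → X)
    (hT : IsZ2MPS μ T) (β b : ℝ) (hb : 0 < b)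
    (α : Finset (Set X)) (hα : IsPartition α)
    (w : ℕ → ℤ × ℤ) (hw : EnumIn w (Lam β b)) :
    seqEnt μ T w α ≤ condEntAlg μ (dirKronAlg μ T β) α := by
  obtain ⟨-, -, hadd, hmp⟩ := hT
  have hgen : ∀ B ∈ dirKron μ T β 1, MeasurableSet B := fun B hB => hB.1
  refine seqEnt_le_condEntAlg hmp (MeasurableSpace.generateFrom_le hgen)
    (fun B hB => ?_) hα hw.2
  exact HasFiniteColourings.of_generateFrom hmp hgen (fun C hC =>
    (HasFiniteColourings.of_isCompact_korbit (fun w => (hmp w).measurable) hC.1 hC.2).of_Lam_one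
      hadd hmp hC.1 b) hB

end Directional
end

section
/- Let $(X,\mathcal{B}_X,\mu,T)$ be a $\mathbb{Z}^2$-MPS, $\vec v=(1,\beta)\in\mathbb{R}^2$ a direction vector and $b\in(0,\infty)$. For every finite measurable partition $\alpha$ of $X$ there exists an infinite subset $S=\{(m_i,n_i)\}_{i=1}^\infty$ of $\Lambda^{\vec v}(b)$ with $\{m_i\}_{i=1}^\infty$ strictly monotone such that $h^S_\mu(T,\alpha)= H_\mu(\alpha\mid\mathcal{K}^{\vec v}_\mu)$ (in particular $h^S_\mu(T,\alpha)\ge H_\mu(\alpha\mid\mathcal{K}^{\vec v}_\mu)$). -/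
open MeasureTheory Filter Set
open scoped ENNReal Topology

namespace Directional

noncomputable section

attribute [local instance] Classical.propDecidable

variable {X : Type*} [MeasurableSpace X] {G : Type*}

end

/-! ### An invariant mean on functions supported in a strip -/

/-- A Banach limit of the averages of `F` over the integers larger than `M`. -/
noncomputable def banachMean (M : ℤ) (F : ℤ → ℝ) : ℝ :=
  limUnder (hyperfilter ℕ : Filter ℕ)
    fun N : ℕ => (∑ i ∈ Finset.range N, F (M + 1 + i)) / (N : ℝ)

lemma abs_average_le {F : ℤ → ℝ} {C : ℝ} (hF : ∀ m, |F m| ≤ C) (M : ℤ) (N : ℕ) :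
    |(∑ i ∈ Finset.range N, F (M + 1 + i)) / (N : ℝ)| ≤ C := by
  have hC : 0 ≤ C := (abs_nonneg _).trans (hF 0)
  rw [abs_div, Nat.abs_cast]
  refine div_le_of_le_mul₀ (Nat.cast_nonneg _) hC ?_
  calc |∑ i ∈ Finset.range N, F (M + 1 + i)|
      ≤ ∑ i ∈ Finset.range N, |F (M + 1 + i)| := Finset.abs_sum_le_sum_abs _ _
    _ ≤ ∑ _i ∈ Finset.range N, C := Finset.sum_le_sum fun i _ => hF _
    _ = C * N := by simp [mul_comm]

lemma tendsto_banachMean {F : ℤ → ℝ} {C : ℝ} (hF : ∀ m, |F m| ≤ C) (M : ℤ) :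
    Tendsto (fun N : ℕ => (∑ i ∈ Finset.range N, F (M + 1 + i)) / (N : ℝ))
      (hyperfilter ℕ : Filter ℕ) (𝓝 (banachMean M F)) := by
  have h : ∃ x ∈ Icc (-C) C, ((hyperfilter ℕ).map
      (fun N : ℕ => (∑ i ∈ Finset.range N, F (M + 1 + i)) / (N : ℝ)) : Filter ℝ) ≤ 𝓝 x := by
    refine isCompact_Icc.ultrafilter_le_nhds _ ?_
    exact le_principal_iff.2 (Filter.mem_map.2 (Filter.Eventually.of_forall fun N =>
      abs_le.1 (abs_average_le hF M N)))
  obtain ⟨x, -, hx⟩ := h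
  exact tendsto_nhds_limUnder ⟨x, hx⟩

lemma banachMean_add {F G : ℤ → ℝ} {C D : ℝ} (hF : ∀ m, |F m| ≤ C) (hG : ∀ m, |G m| ≤ D)
    (M : ℤ) : banachMean M (fun m => F m + G m) = banachMean M F + banachMean M G := by
  refine Tendsto.limUnder_eq ?_
  refine ((tendsto_banachMean hF M).add (tendsto_banachMean hG M)).congr fun N => ?_
  rw [Finset.sum_add_distrib, add_div]

lemma banachMean_const_mul {F : ℤ → ℝ} {C : ℝ} (hF : ∀ m, |F m| ≤ C) (M : ℤ) (c : ℝ) :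
    banachMean M (fun m => c * F m) = c * banachMean M F := by
  refine Tendsto.limUnder_eq ?_
  refine ((tendsto_banachMean hF M).const_mul c).congr fun N => ?_
  rw [← Finset.mul_sum, mul_div_assoc]

lemma banachMean_mono {F G : ℤ → ℝ} {C D : ℝ} (hF : ∀ m, |F m| ≤ C) (hG : ∀ m, |G m| ≤ D)
    {M : ℤ} (h : ∀ m, M < m → F m ≤ G m) : banachMean M F ≤ banachMean M G := by
  refine le_of_tendsto_of_tendsto' (tendsto_banachMean hF M) (tendsto_banachMean hG M) fun N => ?_
  gcongr with i
  exact h _ (by omega)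

lemma banachMean_const (M : ℤ) (c : ℝ) : banachMean M (fun _ => c) = c := by
  refine Tendsto.limUnder_eq ?_
  refine tendsto_const_nhds.congr' ?_
  have : ∀ᶠ N : ℕ in (hyperfilter ℕ : Filter ℕ), 1 ≤ N :=
    Nat.hyperfilter_le_atTop (eventually_ge_atTop 1)
  filter_upwards [this] with N hN
  have : (N : ℝ) ≠ 0 := by positivity
  simp [this]

lemma banachMean_shift_one {F : ℤ → ℝ} {C : ℝ} (hF : ∀ m, |F m| ≤ C) (M : ℤ) :
    banachMean M (fun m => F (m + 1)) = banachMean M F := by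
  refine Tendsto.limUnder_eq ?_
  have h0 : Tendsto (fun N : ℕ => (F (M + 1 + N) - F (M + 1)) / (N : ℝ))
      (hyperfilter ℕ : Filter ℕ) (𝓝 0) := by
    refine Tendsto.mono_left ?_ Nat.hyperfilter_le_atTop
    refine squeeze_zero_norm (a := fun N : ℕ => (2 * C) / (N : ℝ)) (fun N => ?_)
      (tendsto_const_div_atTop_nhds_zero_nat _)
    rw [Real.norm_eq_abs, abs_div, Nat.abs_cast]
    gcongr
    calc _ ≤ |F (M + 1 + N)| + |F (M + 1)| := abs_sub _ _
      _ ≤ 2 * C := by linarith [hF (M + 1 + N), hF (M + 1)]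
  have := (tendsto_banachMean hF M).add h0
  rw [add_zero] at this
  refine this.congr fun N => ?_
  rw [← add_div]
  congr 1
  have h1 := Finset.sum_range_succ (fun i : ℕ => F (M + 1 + i)) N
  have h2 := Finset.sum_range_succ' (fun i : ℕ => F (M + 1 + i)) N
  have h3 : ∑ i ∈ Finset.range N, F (M + 1 + (i + 1 : ℕ)) =
      ∑ i ∈ Finset.range N, F (M + 1 + i + 1) :=
    Finset.sum_congr rfl fun i _ => by push_cast; congr 1; ring
  simp only [Nat.cast_zero, add_zero] at h2
  linarith

lemma banachMean_shift {F : ℤ → ℝ} {C : ℝ} (hF : ∀ m, |F m| ≤ C) (M p : ℤ) :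
    banachMean M (fun m => F (m + p)) = banachMean M F := by
  induction p using Int.induction_on with
  | zero => simp
  | succ i ih =>
    rw [← ih, ← banachMean_shift_one (F := fun m => F (m + i)) (fun m => hF _)]
    congr 1; ext m; congr 1; ring
  | pred i ih =>
    rw [← ih, ← banachMean_shift_one (F := fun m => F (m + (-i - 1))) (fun m => hF _)]
    congr 1; ext m; congr 1; ring

/-- Bounded functions on `ℤ²` which vanish outside a strip of slope `β`. -/
def StripBdd (β : ℝ) (φ : ℤ × ℤ → ℝ) : Prop :=
  ∃ R C : ℝ, ∀ w, |φ w| ≤ C ∧ (R < |(w.2 : ℝ) - β * w.1| → φ w = 0)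

namespace StripBdd

variable {β : ℝ} {φ ψ : ℤ × ℤ → ℝ}

lemma of_abs_le {R C : ℝ} (h : ∀ w, |φ w| ≤ C)
    (h' : ∀ w : ℤ × ℤ, R < |(w.2 : ℝ) - β * w.1| → φ w = 0) : StripBdd β φ :=
  ⟨R, C, fun w => ⟨h w, h' w⟩⟩

lemma add (hφ : StripBdd β φ) (hψ : StripBdd β ψ) : StripBdd β (fun w => φ w + ψ w) := by
  obtain ⟨R, C, h⟩ := hφ
  obtain ⟨R', C', h'⟩ := hψ
  refine ⟨max R R', C + C', fun w => ⟨?_, fun hw => ?_⟩⟩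
  · exact (abs_add_le _ _).trans (add_le_add (h w).1 (h' w).1)
  · rw [max_lt_iff] at hw
    simp only [(h w).2 hw.1, (h' w).2 hw.2, add_zero]

lemma mul_bdd (hφ : StripBdd β φ) {D : ℝ} (hψ : ∀ w, |ψ w| ≤ D) :
    StripBdd β (fun w => φ w * ψ w) := by
  obtain ⟨R, C, h⟩ := hφ
  refine ⟨R, C * D, fun w => ⟨?_, fun hw => by simp only [(h w).2 hw, zero_mul]⟩⟩
  rw [abs_mul]
  exact mul_le_mul (h w).1 (hψ w) (abs_nonneg _) ((abs_nonneg _).trans (h w).1)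

lemma const_mul (hφ : StripBdd β φ) (c : ℝ) : StripBdd β (fun w => c * φ w) := by
  simpa only [mul_comm] using hφ.mul_bdd (ψ := fun _ => c) (fun _ => le_refl |c|)

lemma sum {ι : Type*} (s : Finset ι) {φ : ι → ℤ × ℤ → ℝ} (h : ∀ i ∈ s, StripBdd β (φ i)) :
    StripBdd β (fun w => ∑ i ∈ s, φ i w) := by
  classical
  induction s using Finset.induction_on with
  | empty => exact ⟨0, 0, fun w => by simp⟩
  | insert a s ha ih =>
    simp only [Finset.sum_insert ha]
    exact (h a (by simp)).add (ih fun i hi => h i (by simp [hi]))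

lemma eq_zero_of_notMem_Icc {R C : ℝ} (h : ∀ w, |φ w| ≤ C ∧ (R < |(w.2 : ℝ) - β * w.1| → φ w = 0))
    {m n : ℤ} (hn : n ∉ Finset.Icc ⌈β * m - R⌉ ⌊β * m + R⌋) : φ (m, n) = 0 := by
  refine (h _).2 ?_
  by_contra! hc
  refine hn (Finset.mem_Icc.2 ⟨Int.ceil_le.2 ?_, Int.le_floor.2 ?_⟩) <;>
  · have := abs_le.1 hc
    simp only at this
    linarith

lemma summable (hφ : StripBdd β φ) (m : ℤ) : Summable fun n => φ (m, n) := by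
  obtain ⟨R, C, h⟩ := hφ
  exact summable_of_ne_finset_zero (s := Finset.Icc ⌈β * m - R⌉ ⌊β * m + R⌋)
    fun n hn => eq_zero_of_notMem_Icc h hn

lemma abs_tsum_le {R C : ℝ} (hR : 0 ≤ R)
    (h : ∀ w, |φ w| ≤ C ∧ (R < |(w.2 : ℝ) - β * w.1| → φ w = 0)) (m : ℤ) :
    |∑' n, φ (m, n)| ≤ C * (2 * R + 1) := by
  have hC : 0 ≤ C := (abs_nonneg _).trans (h 0).1
  rw [tsum_eq_sum (s := Finset.Icc ⌈β * m - R⌉ ⌊β * m + R⌋)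
    fun n hn => eq_zero_of_notMem_Icc h hn]
  calc _ ≤ ∑ n ∈ Finset.Icc ⌈β * m - R⌉ ⌊β * m + R⌋, |φ (m, n)| := Finset.abs_sum_le_sum_abs _ _
    _ ≤ ∑ n ∈ Finset.Icc ⌈β * m - R⌉ ⌊β * m + R⌋, C := Finset.sum_le_sum fun i _ => (h _).1
    _ = C * ((⌊β * m + R⌋ + 1 - ⌈β * m - R⌉).toNat : ℝ) := by simp [mul_comm]
    _ ≤ C * (2 * R + 1) := by
      gcongr
      have h1 := Int.floor_le (β * m + R)
      have h2 := Int.le_ceil (β * m - R)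
      have h3 : ((⌊β * m + R⌋ + 1 - ⌈β * m - R⌉).toNat : ℝ) =
          ((max (⌊β * m + R⌋ + 1 - ⌈β * m - R⌉) 0 : ℤ) : ℝ) := by
        rw [← Int.toNat_eq_max]; norm_cast
      rw [h3]; push_cast
      refine max_le ?_ (by linarith)
      linarith

lemma exists_abs_tsum_le (hφ : StripBdd β φ) : ∃ C, ∀ m : ℤ, |∑' n, φ (m, n)| ≤ C := by
  obtain ⟨R, C, h⟩ := hφ
  exact ⟨C * (2 * max R 0 + 1), abs_tsum_le (le_max_right _ _)
    fun w => ⟨(h w).1, fun hw => (h w).2 ((le_max_left _ _).trans_lt hw)⟩⟩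

end StripBdd

/-- The mean of a strip function over the columns to the right of `M`. -/
noncomputable def stripMean (M : ℤ) (φ : ℤ × ℤ → ℝ) : ℝ :=
  banachMean M fun m => ∑' n, φ (m, n)

section stripMean

variable {β : ℝ} {φ ψ : ℤ × ℤ → ℝ}

lemma stripMean_add (M : ℤ) (hφ : StripBdd β φ) (hψ : StripBdd β ψ) :
    stripMean M (fun w => φ w + ψ w) = stripMean M φ + stripMean M ψ := by
  obtain ⟨C, hC⟩ := hφ.exists_abs_tsum_le
  obtain ⟨D, hD⟩ := hψ.exists_abs_tsum_le
  rw [stripMean, stripMean, stripMean, ← banachMean_add hC hD]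
  congr 1; ext m
  exact (hφ.summable m).tsum_add (hψ.summable m)

lemma stripMean_const_mul (M : ℤ) (hφ : StripBdd β φ) (c : ℝ) :
    stripMean M (fun w => c * φ w) = c * stripMean M φ := by
  obtain ⟨C, hC⟩ := hφ.exists_abs_tsum_le
  rw [stripMean, stripMean, ← banachMean_const_mul hC]
  congr 1; ext m
  exact tsum_mul_left

lemma stripMean_zero (M : ℤ) : stripMean M (fun _ => 0) = 0 := by
  simp [stripMean, banachMean_const]

lemma stripMean_sum (M : ℤ) {ι : Type*} (s : Finset ι) {φ : ι → ℤ × ℤ → ℝ}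
    (h : ∀ i ∈ s, StripBdd β (φ i)) :
    stripMean M (fun w => ∑ i ∈ s, φ i w) = ∑ i ∈ s, stripMean M (φ i) := by
  classical
  induction s using Finset.induction_on with
  | empty => simp [stripMean_zero]
  | insert a s ha ih =>
    simp only [Finset.sum_insert ha]
    rw [stripMean_add M (h a (by simp)) (StripBdd.sum s fun i hi => h i (by simp [hi])),
      ih fun i hi => h i (by simp [hi])]

lemma stripMean_mono {M : ℤ} (hφ : StripBdd β φ) (hψ : StripBdd β ψ)
    (h : ∀ w : ℤ × ℤ, M < w.1 → φ w ≤ ψ w) : stripMean M φ ≤ stripMean M ψ := by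
  obtain ⟨C, hC⟩ := hφ.exists_abs_tsum_le
  obtain ⟨D, hD⟩ := hψ.exists_abs_tsum_le
  exact banachMean_mono hC hD fun m hm =>
    (hφ.summable m).tsum_le_tsum (fun n => h (m, n) hm) (hψ.summable m)

lemma stripMean_shift (M : ℤ) (hφ : StripBdd β φ) (v : ℤ × ℤ) :
    stripMean M (fun w => φ (w + v)) = stripMean M φ := by
  obtain ⟨C, hC⟩ := hφ.exists_abs_tsum_le
  rw [stripMean, stripMean, ← banachMean_shift hC M v.1]
  congr 1; ext m
  exact (Equiv.addRight v.2).tsum_eq fun n => φ (m + v.1, n)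

lemma abs_stripMean_le (M : ℤ) {R C : ℝ} (hR : 0 ≤ R) (h : ∀ w, |φ w| ≤ C)
    (h' : ∀ w : ℤ × ℤ, R < |(w.2 : ℝ) - β * w.1| → φ w = 0) :
    |stripMean M φ| ≤ C * (2 * R + 1) := by
  have hb := StripBdd.abs_tsum_le hR fun w => ⟨h w, h' w⟩
  rw [abs_le]
  constructor
  · rw [← banachMean_const M (-(C * (2 * R + 1)))]
    exact banachMean_mono (fun _ => le_rfl) hb fun m _ => (abs_le.1 (hb m)).1
  · conv_rhs => rw [← banachMean_const M (C * (2 * R + 1))]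
    exact banachMean_mono hb (fun _ => le_rfl) fun m _ => (abs_le.1 (hb m)).2

end stripMean

/-- The tent function of half-width `c`, centred at `s`, in the transverse coordinate. -/
noncomputable def tent (β c s : ℝ) (w : ℤ × ℤ) : ℝ :=
  max 0 (1 - |(w.2 : ℝ) - β * w.1 - s| / c)

section tent

variable {β c s : ℝ}

lemma tent_nonneg (w : ℤ × ℤ) : 0 ≤ tent β c s w := le_max_left _ _

lemma tent_le_one (hc : 0 < c) (w : ℤ × ℤ) : tent β c s w ≤ 1 :=
  max_le zero_le_one (by linarith [div_nonneg (abs_nonneg ((w.2 : ℝ) - β * w.1 - s)) hc.le])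

lemma tent_eq_zero (hc : 0 < c) {w : ℤ × ℤ} (h : c ≤ |(w.2 : ℝ) - β * w.1 - s|) :
    tent β c s w = 0 :=
  max_eq_left (by linarith [(one_le_div hc).2 h])

lemma tent_eq_zero_of_lt (hc : 0 < c) {w : ℤ × ℤ} (h : c + |s| < |(w.2 : ℝ) - β * w.1|) :
    tent β c s w = 0 :=
  tent_eq_zero hc (by linarith [abs_sub_abs_le_abs_sub ((w.2 : ℝ) - β * w.1) s])

lemma tent_add (w v : ℤ × ℤ) : tent β c (s + ((v.2 : ℝ) - β * v.1)) (w + v) = tent β c s w := by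
  simp only [tent, Prod.fst_add, Prod.snd_add]
  push_cast
  congr 4
  ring

lemma stripBdd_tent (hc : 0 < c) : StripBdd β (tent β c s) :=
  StripBdd.of_abs_le (R := c + |s|) (C := 1)
    (fun w => by rw [abs_of_nonneg (tent_nonneg w)]; exact tent_le_one hc w)
    (fun _ h => tent_eq_zero_of_lt hc h)

lemma abs_tent_sub_tent_le (hc : 0 < c) (s' : ℝ) (w : ℤ × ℤ) :
    |tent β c s w - tent β c s' w| ≤ |s - s'| / c := by
  rw [tent, tent, max_comm 0, max_comm 0]
  refine (abs_max_sub_max_le_abs _ _ _).trans ?_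
  rw [sub_sub_sub_cancel_left, ← sub_div, abs_div, abs_of_pos hc]
  refine div_le_div_of_nonneg_right ((abs_abs_sub_abs_le_abs_sub _ _).trans (le_of_eq ?_)) hc.le
  congr 1; ring

lemma stripMean_tent_pos (M : ℤ) (hc : 0 < c) : 0 < stripMean M (tent β c 0) := by
  have htb : TotallyBounded ((fun w : ℤ × ℤ => (w.2 : ℝ) - β * w.1) '' Lam β 1) := by
    refine (totallyBounded_Icc (-(1 / 2) : ℝ) (1 / 2)).subset ?_
    rintro _ ⟨w, hw, rfl⟩
    exact ⟨by linarith [hw.1], by linarith [hw.2]⟩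
  obtain ⟨t, ht, hfin, hcov⟩ := Metric.finite_approx_of_totallyBounded htb (c / 2) (by linarith)
  classical
  set χ : ℤ × ℤ → ℝ := fun w => if w ∈ Lam β 1 then 1 else 0 with hχ
  have hχb : StripBdd β χ := by
    refine StripBdd.of_abs_le (R := 1 / 2) (C := 1) (fun w => ?_) fun w hw => if_neg fun h => ?_
    · by_cases h : w ∈ Lam β 1 <;> simp [hχ, h]
    · exact hw.not_ge (abs_le.2 ⟨by linarith [h.1], by linarith [h.2]⟩)
  have hone : 1 ≤ stripMean M χ := by
    obtain ⟨C, hC⟩ := hχb.exists_abs_tsum_le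
    rw [← banachMean_const M 1]
    refine banachMean_mono (fun _ => le_rfl) hC fun m _ => ?_
    have hr := abs_le.1 (abs_sub_round (β * m))
    have hmem : (m, round (β * m)) ∈ Lam β 1 := ⟨by simp only; linarith, by simp only; linarith⟩
    calc (1 : ℝ) = χ (m, round (β * m)) := (if_pos hmem).symm
      _ ≤ ∑' n, χ (m, n) := (hχb.summable m).le_tsum _ fun n _ => by
        by_cases h : (m, n) ∈ Lam β 1 <;> simp [hχ, h]
  have hsum : stripMean M χ ≤ stripMean M fun w => ∑ y ∈ hfin.toFinset, 2 * tent β c y w := by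
    refine stripMean_mono hχb (StripBdd.sum _ fun y _ => (stripBdd_tent hc).const_mul 2) fun w _ => ?_
    by_cases h : w ∈ Lam β 1
    · obtain ⟨y, hy, hwy⟩ := mem_iUnion₂.1 (hcov ⟨w, h, rfl⟩)
      rw [Metric.mem_ball, Real.dist_eq] at hwy
      have h2 : |(w.2 : ℝ) - β * w.1 - y| / c ≤ 1 / 2 := by
        rw [div_le_iff₀ hc]; linarith
      have h3 : 1 - |(w.2 : ℝ) - β * w.1 - y| / c ≤ tent β c y w := le_max_right _ _
      calc χ w = 1 := if_pos h
        _ ≤ 2 * tent β c y w := by linarith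
        _ ≤ _ := Finset.single_le_sum (f := fun y => 2 * tent β c y w)
          (fun i _ => mul_nonneg zero_le_two (tent_nonneg w)) (hfin.mem_toFinset.2 hy)
    · calc χ w = 0 := if_neg h
        _ ≤ _ := Finset.sum_nonneg fun i _ => mul_nonneg zero_le_two (tent_nonneg w)
  have heq : ∀ y ∈ hfin.toFinset, stripMean M (fun w => 2 * tent β c y w) =
      2 * stripMean M (tent β c 0) := fun y hy => by
    obtain ⟨v, -, rfl⟩ := ht (hfin.mem_toFinset.1 hy)
    rw [stripMean_const_mul M (stripBdd_tent hc), ← stripMean_shift M (stripBdd_tent hc) v]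
    congr 2; ext w
    rw [← tent_add w v, zero_add]
  rw [stripMean_sum M _ fun y _ => (stripBdd_tent hc).const_mul 2, Finset.sum_congr rfl heq,
    Finset.sum_const, nsmul_eq_mul] at hsum
  by_contra! hneg
  have : (hfin.toFinset.card : ℝ) * (2 * stripMean M (tent β c 0)) ≤ 0 :=
    mul_nonpos_of_nonneg_of_nonpos (Nat.cast_nonneg _) (by linarith)
  linarith

end tent

/-! ### Almost periodic vectors and mean correlations along a strip -/

section Hilbert

variable {H : Type*} [NormedAddCommGroup H] [InnerProductSpace ℝ H]

open scoped RealInnerProductSpace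

lemma totallyBounded_of_forall_approx {E : Type*} [PseudoMetricSpace E] {s : Set E}
    (h : ∀ ε > 0, ∃ t : Set E, TotallyBounded t ∧ ∀ x ∈ s, ∃ y ∈ t, dist x y < ε) :
    TotallyBounded s := by
  rw [Metric.totallyBounded_iff]
  intro ε hε
  obtain ⟨t, ht, hst⟩ := h (ε / 2) (half_pos hε)
  obtain ⟨u, hu, htu⟩ := Metric.totallyBounded_iff.1 ht (ε / 2) (half_pos hε)
  refine ⟨u, hu, fun x hx => ?_⟩
  obtain ⟨y, hy, hxy⟩ := hst x hx
  obtain ⟨z, hz, hyz⟩ := mem_iUnion₂.1 (htu hy)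
  refine mem_iUnion₂.2 ⟨z, hz, ?_⟩
  rw [Metric.mem_ball] at hyz ⊢
  linarith [dist_triangle x y z]

lemma totallyBounded_prod {E F : Type*} [PseudoMetricSpace E] [PseudoMetricSpace F] {s : Set E}
    {t : Set F} (hs : TotallyBounded s) (ht : TotallyBounded t) : TotallyBounded (s ×ˢ t) := by
  rw [Metric.totallyBounded_iff] at *
  intro ε hε
  obtain ⟨u, hu, hsu⟩ := hs ε hε
  obtain ⟨v, hv, htv⟩ := ht ε hε
  refine ⟨u ×ˢ v, hu.prod hv, fun p hp => ?_⟩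
  obtain ⟨x, hx, hpx⟩ := mem_iUnion₂.1 (hsu hp.1)
  obtain ⟨y, hy, hpy⟩ := mem_iUnion₂.1 (htv hp.2)
  exact mem_iUnion₂.2 ⟨(x, y), ⟨hx, hy⟩, by
    rw [Metric.mem_ball, Prod.dist_eq]; exact max_lt hpx hpy⟩

/-- A positive operator whose diagonal sums over orthonormal families are bounded maps bounded
sets to totally bounded sets. -/
lemma totallyBounded_image_of_trace_le (A : H →L[ℝ] H) {C : ℝ} (hC : 0 < C)
    (hpos : ∀ x, ‖A x‖ ^ 2 ≤ C * ⟪A x, x⟫)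
    (htr : ∀ s : Finset H, Orthonormal ℝ ((↑) : s → H) → ∑ e ∈ s, ⟪A e, e⟫ ≤ C) {r : ℝ}
    (hr : 0 < r) : TotallyBounded (A '' Metric.closedBall 0 r) := by
  classical
  refine totallyBounded_of_forall_approx fun ε hε => ?_
  set S : Set ℝ := {a | ∃ s : Finset H, Orthonormal ℝ ((↑) : s → H) ∧ ∑ e ∈ s, ⟪A e, e⟫ = a}
  have hne : S.Nonempty := ⟨0, ∅, by simp [Orthonormal], by simp⟩
  have hbdd : BddAbove S := ⟨C, by rintro _ ⟨s, hs, rfl⟩; exact htr s hs⟩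
  have hδ : 0 < (ε / (2 * r)) ^ 2 / C := by positivity
  obtain ⟨_, ⟨s, hs, rfl⟩, hlt⟩ := exists_lt_of_lt_csSup hne (sub_lt_self (sSup S) hδ)
  set V : Submodule ℝ H := Submodule.span ℝ (s : Set H)
  have : FiniteDimensional ℝ V := FiniteDimensional.span_finset ℝ s
  have hunit : ∀ u ∈ Vᗮ, ‖u‖ = 1 → ⟪A u, u⟫ ≤ (ε / (2 * r)) ^ 2 / C := fun u hu hu1 => by
    have horth : ∀ e ∈ s, ⟪e, u⟫ = 0 := fun e he =>
      (Submodule.mem_orthogonal V u).1 hu e (Submodule.subset_span he)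
    have hus : u ∉ s := fun h => by
      have := horth u h
      rw [real_inner_self_eq_norm_sq, hu1] at this
      norm_num at this
    have hs' : Orthonormal ℝ ((↑) : ↥(insert u s) → H) := by
      refine ⟨?_, ?_⟩
      · rintro ⟨e, he⟩
        rcases Finset.mem_insert.1 he with rfl | he
        · exact hu1
        · exact hs.1 ⟨e, he⟩
      · rintro ⟨e, he⟩ ⟨f, hf⟩ hef
        have hef' : e ≠ f := fun h => hef (Subtype.ext h)
        rcases Finset.mem_insert.1 he with h₁ | h₁ <;> rcases Finset.mem_insert.1 hf with h₂ | h₂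
        · exact absurd (h₁.trans h₂.symm) hef'
        · change ⟪e, f⟫ = 0
          rw [h₁, real_inner_comm, horth f h₂]
        · change ⟪e, f⟫ = 0
          rw [h₂, horth e h₁]
        · exact hs.2 (i := ⟨e, h₁⟩) (j := ⟨f, h₂⟩) fun h => hef' (congrArg Subtype.val h)
    have := le_csSup hbdd ⟨_, hs', rfl⟩
    rw [Finset.sum_insert hus] at this
    linarith
  have hperp : ∀ u ∈ Vᗮ, ‖A u‖ ≤ ε / (2 * r) * ‖u‖ := fun u hu => by
    rcases eq_or_ne u 0 with rfl | h0
    · simp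
    have hn : 0 < ‖u‖ := norm_pos_iff.2 h0
    have h1 : ‖‖u‖⁻¹ • u‖ = 1 := by rw [norm_smul, norm_inv, norm_norm, inv_mul_cancel₀ hn.ne']
    have h2 := hunit _ (Vᗮ.smul_mem ‖u‖⁻¹ hu) h1
    have h3 := hpos (‖u‖⁻¹ • u)
    have h4 : ‖A (‖u‖⁻¹ • u)‖ ^ 2 ≤ (ε / (2 * r)) ^ 2 := by
      rw [le_div_iff₀ hC] at h2; linarith
    have h5 := le_of_sq_le_sq h4 (by positivity)
    rw [map_smul, norm_smul, norm_inv, norm_norm, inv_mul_le_iff₀ hn] at h5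
    linarith
  refine ⟨A '' (V.subtype '' Metric.closedBall 0 r), ?_, ?_⟩
  · refine TotallyBounded.image ?_ A.uniformContinuous
    refine TotallyBounded.image ?_ V.subtypeL.uniformContinuous
    exact (isCompact_closedBall _ _).totallyBounded
  · rintro _ ⟨x, hx, rfl⟩
    refine ⟨A (V.starProjection x), ⟨_, ⟨V.orthogonalProjectionOnto x, ?_, rfl⟩, rfl⟩, ?_⟩
    · rw [mem_closedBall_zero_iff] at hx ⊢
      exact (V.norm_orthogonalProjectionOnto_apply_le x).trans hx
    · rw [dist_eq_norm, ← map_sub]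
      have hx' : ‖x‖ ≤ r := mem_closedBall_zero_iff.1 hx
      have hmem : x - V.starProjection x ∈ Vᗮ := V.sub_starProjection_mem_orthogonal x
      have hle : ‖x - V.starProjection x‖ ≤ ‖x‖ := by
        rw [← V.starProjection_orthogonal_val]
        exact Vᗮ.norm_orthogonalProjectionOnto_apply_le x
      calc _ ≤ ε / (2 * r) * ‖x - V.starProjection x‖ := hperp _ hmem
        _ ≤ ε / (2 * r) * r := by gcongr; exact hle.trans hx'
        _ = ε / 2 := by field_simp
        _ < ε := half_lt_self hε

/-- `U` is an isometric representation of `ℤ²`. -/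
structure IsRep (U : ℤ × ℤ → H →ₗᵢ[ℝ] H) : Prop where
  zero : ∀ x, U 0 x = x
  add : ∀ v w x, U (v + w) x = U v (U w x)

/-- `f` has a totally bounded orbit along `Λ`. -/
def AlmostPeriodic (U : ℤ × ℤ → H →ₗᵢ[ℝ] H) (Λ : Set (ℤ × ℤ)) (f : H) : Prop :=
  TotallyBounded ((fun w => U w f) '' Λ)

namespace AlmostPeriodic

variable {U : ℤ × ℤ → H →ₗᵢ[ℝ] H} {Λ : Set (ℤ × ℤ)} {f g : H}

lemma of_uniformContinuous_map₂ (hf : AlmostPeriodic U Λ f) (hg : AlmostPeriodic U Λ g)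
    {Φ : H × H → H} (hΦ : UniformContinuous Φ) {k : H} (h : ∀ w, U w k = Φ (U w f, U w g)) :
    AlmostPeriodic U Λ k := by
  refine ((totallyBounded_prod hf hg).image hΦ).subset ?_
  rintro _ ⟨w, hw, rfl⟩
  exact ⟨(U w f, U w g), ⟨⟨w, hw, rfl⟩, ⟨w, hw, rfl⟩⟩, (h w).symm⟩

lemma of_uniformContinuous_map (hf : AlmostPeriodic U Λ f)
    {Φ : H → H} (hΦ : UniformContinuous Φ) {k : H} (h : ∀ w, U w k = Φ (U w f)) :
    AlmostPeriodic U Λ k :=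
  of_uniformContinuous_map₂ hf hf (Φ := fun p => Φ p.1) (hΦ.comp uniformContinuous_fst) h

lemma add (hf : AlmostPeriodic U Λ f) (hg : AlmostPeriodic U Λ g) : AlmostPeriodic U Λ (f + g) :=
  of_uniformContinuous_map₂ hf hg uniformContinuous_add fun _ => map_add _ _ _

lemma sub (hf : AlmostPeriodic U Λ f) (hg : AlmostPeriodic U Λ g) : AlmostPeriodic U Λ (f - g) :=
  of_uniformContinuous_map₂ hf hg uniformContinuous_sub fun _ => map_sub _ _ _

lemma smul (hf : AlmostPeriodic U Λ f) (c : ℝ) : AlmostPeriodic U Λ (c • f) :=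
  of_uniformContinuous_map hf (uniformContinuous_const_smul c) fun _ => map_smul _ _ _

lemma neg (hf : AlmostPeriodic U Λ f) : AlmostPeriodic U Λ (-f) :=
  of_uniformContinuous_map hf uniformContinuous_neg fun _ => map_neg _ _

lemma map (hU : IsRep U) (hf : AlmostPeriodic U Λ f) (v : ℤ × ℤ) : AlmostPeriodic U Λ (U v f) :=
  of_uniformContinuous_map hf (U v).isometry.uniformContinuous fun w => by
    rw [← hU.add, add_comm, hU.add]

lemma of_forall_approx (h : ∀ ε > 0, ∃ g, AlmostPeriodic U Λ g ∧ dist f g < ε) :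
    AlmostPeriodic U Λ f := by
  refine totallyBounded_of_forall_approx fun ε hε => ?_
  obtain ⟨g, hg, hfg⟩ := h ε hε
  refine ⟨_, hg, ?_⟩
  rintro _ ⟨w, hw, rfl⟩
  exact ⟨U w g, ⟨w, hw, rfl⟩, by rwa [(U w).dist_map]⟩

end AlmostPeriodic

section corr

variable {U : ℤ × ℤ → H →ₗᵢ[ℝ] H} {β c s : ℝ} {f : H}

lemma IsRep.inner_map_left (hU : IsRep U) (v : ℤ × ℤ) (x y : H) :
    ⟪U v x, y⟫ = ⟪x, U (-v) y⟫ := by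
  rw [← (U v).inner_map_map x, ← hU.add, add_neg_cancel, hU.zero]

lemma abs_inner_mul_inner_le (U : ℤ × ℤ → H →ₗᵢ[ℝ] H) (f g h : H) (w : ℤ × ℤ) :
    |⟪U w f, g⟫ * ⟪U w f, h⟫| ≤ (‖f‖ * ‖g‖) * (‖f‖ * ‖h‖) := by
  rw [abs_mul]
  have h1 := abs_real_inner_le_norm (U w f) g
  have h2 := abs_real_inner_le_norm (U w f) h
  rw [(U w).norm_map] at h1 h2
  exact mul_le_mul h1 h2 (abs_nonneg _) (by positivity)

/-- The mean of the correlations of `g` and `h` with the translates of `f` along a strip. -/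
noncomputable def corr (M : ℤ) (β c : ℝ) (U : ℤ × ℤ → H →ₗᵢ[ℝ] H) (f : H) (s : ℝ)
    (g h : H) : ℝ :=
  stripMean M fun w => tent β c s w * (⟪U w f, g⟫ * ⟪U w f, h⟫)

lemma stripBdd_corr (hc : 0 < c) (g h : H) :
    StripBdd β fun w => tent β c s w * (⟪U w f, g⟫ * ⟪U w f, h⟫) :=
  (stripBdd_tent hc).mul_bdd (abs_inner_mul_inner_le U f g h)

lemma corr_comm (M : ℤ) (g h : H) : corr M β c U f s g h = corr M β c U f s h g := by
  simp only [corr, mul_comm]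

lemma corr_add_right (M : ℤ) (hc : 0 < c) (g h h' : H) :
    corr M β c U f s g (h + h') = corr M β c U f s g h + corr M β c U f s g h' := by
  rw [corr, corr, corr, ← stripMean_add M (stripBdd_corr hc g h) (stripBdd_corr hc g h')]
  simp only [inner_add_right, mul_add]

lemma corr_smul_right (M : ℤ) (hc : 0 < c) (a : ℝ) (g h : H) :
    corr M β c U f s g (a • h) = a * corr M β c U f s g h := by
  rw [corr, corr, ← stripMean_const_mul M (stripBdd_corr hc g h)]
  congr 1; ext w
  rw [real_inner_smul_right]; ring

lemma abs_corr_sub_corr_le (M : ℤ) (hc : 0 < c) {R : ℝ} (s' : ℝ) (hs : |s| ≤ R) (hs' : |s'| ≤ R)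
    (g h : H) : |corr M β c U f s g h - corr M β c U f s' g h| ≤
      (|s - s'| / c * ((‖f‖ * ‖g‖) * (‖f‖ * ‖h‖))) * (2 * (c + R) + 1) := by
  have hR : 0 ≤ R := (abs_nonneg s).trans hs
  have e : corr M β c U f s g h - corr M β c U f s' g h =
      stripMean M fun w => (tent β c s w - tent β c s' w) * (⟪U w f, g⟫ * ⟪U w f, h⟫) := by
    rw [sub_eq_add_neg, ← neg_one_mul (corr M β c U f s' g h), corr, corr,
      ← stripMean_const_mul M (stripBdd_corr hc g h),
      ← stripMean_add M (stripBdd_corr hc g h) ((stripBdd_corr hc g h).const_mul _)]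
    congr 1; ext w; ring
  rw [e]
  refine abs_stripMean_le (β := β) M (by linarith) (fun w => ?_) fun w hw => ?_
  · rw [abs_mul]
    gcongr
    · exact abs_tent_sub_tent_le hc s' w
    · exact abs_inner_mul_inner_le U f g h w
  · rw [tent_eq_zero_of_lt hc (by linarith), tent_eq_zero_of_lt hc (by linarith)]
    ring

lemma abs_corr_le (M : ℤ) (hc : 0 < c) {R : ℝ} (hs : |s| ≤ R) (g h : H) :
    |corr M β c U f s g h| ≤ ((‖f‖ * ‖g‖) * (‖f‖ * ‖h‖)) * (2 * (c + R) + 1) := by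
  have hR : 0 ≤ R := (abs_nonneg s).trans hs
  refine abs_stripMean_le (β := β) M (by linarith) (fun w => ?_) fun w hw => ?_
  · rw [abs_mul, abs_of_nonneg (tent_nonneg w)]
    exact (mul_le_of_le_one_left (abs_nonneg _) (tent_le_one hc w)).trans
      (abs_inner_mul_inner_le U f g h w)
  · rw [tent_eq_zero_of_lt hc (by linarith), zero_mul]

lemma corr_map (hU : IsRep U) (M : ℤ) (hc : 0 < c) (v : ℤ × ℤ) (g h : H) :
    corr M β c U f (s + ((v.2 : ℝ) - β * v.1)) (U v g) (U v h) = corr M β c U f s g h := by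
  rw [corr, corr, ← stripMean_shift M (stripBdd_corr hc (U v g) (U v h)) v]
  congr 1; ext w
  rw [tent_add, add_comm w v, hU.add, (U v).inner_map_map, (U v).inner_map_map]

lemma corr_le (M : ℤ) (hc : 0 < c) {t : ℝ} (ht : 0 < t) (g h : H) :
    corr M β c U f s g h ≤ t / 2 * corr M β c U f s g g + 1 / (2 * t) * corr M β c U f s h h := by
  have hgg := stripBdd_corr (U := U) (f := f) (s := s) (β := β) hc g g
  have hhh := stripBdd_corr (U := U) (f := f) (s := s) (β := β) hc h h
  rw [corr, corr, corr, ← stripMean_const_mul M hgg, ← stripMean_const_mul M hhh,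
    ← stripMean_add M (hgg.const_mul _) (hhh.const_mul _)]
  refine stripMean_mono (stripBdd_corr hc g h) ((hgg.const_mul _).add (hhh.const_mul _))
    fun w _ => ?_
  have key : ⟪U w f, g⟫ * ⟪U w f, h⟫ ≤
      t / 2 * (⟪U w f, g⟫ * ⟪U w f, g⟫) + 1 / (2 * t) * (⟪U w f, h⟫ * ⟪U w f, h⟫) := by
    have : t / 2 * (⟪U w f, g⟫ * ⟪U w f, g⟫) + 1 / (2 * t) * (⟪U w f, h⟫ * ⟪U w f, h⟫) -
        ⟪U w f, g⟫ * ⟪U w f, h⟫ = 1 / (2 * t) * (t * ⟪U w f, g⟫ - ⟪U w f, h⟫) ^ 2 := by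
      field_simp; ring
    have h0 : 0 ≤ 1 / (2 * t) * (t * ⟪U w f, g⟫ - ⟪U w f, h⟫) ^ 2 := by positivity
    linarith
  calc _ ≤ tent β c s w * (t / 2 * (⟪U w f, g⟫ * ⟪U w f, g⟫) +
        1 / (2 * t) * (⟪U w f, h⟫ * ⟪U w f, h⟫)) :=
      mul_le_mul_of_nonneg_left key (tent_nonneg w)
    _ = _ := by ring

lemma sum_corr_le (M : ℤ) (hc : 0 < c) {R : ℝ} (hs : |s| ≤ R) (t : Finset H)
    (ht : Orthonormal ℝ ((↑) : t → H)) :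
    ∑ e ∈ t, corr M β c U f s e e ≤ ‖f‖ ^ 2 * (2 * (c + R) + 1) := by
  have hR : 0 ≤ R := (abs_nonneg s).trans hs
  have hbes : ∀ w, ∑ e ∈ t, ⟪U w f, e⟫ * ⟪U w f, e⟫ ≤ ‖f‖ ^ 2 := fun w => by
    have := ht.sum_inner_products_le (U w f) (s := Finset.univ)
    rw [(U w).norm_map, Finset.univ_eq_attach,
      Finset.sum_attach t fun e => ‖⟪e, U w f⟫‖ ^ 2] at this
    refine le_trans (Finset.sum_le_sum fun e _ => ?_) this
    rw [Real.norm_eq_abs, sq_abs, real_inner_comm, sq]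
  simp only [corr]
  rw [← stripMean_sum M t fun e _ => stripBdd_corr hc e e]
  refine (le_abs_self _).trans (abs_stripMean_le (β := β) M (by linarith) (fun w => ?_)
    fun w hw => ?_)
  · have h0 : 0 ≤ ∑ e ∈ t, ⟪U w f, e⟫ * ⟪U w f, e⟫ :=
      Finset.sum_nonneg fun e _ => mul_self_nonneg _
    rw [← Finset.mul_sum, abs_of_nonneg (mul_nonneg (tent_nonneg w) h0)]
    exact (mul_le_of_le_one_left h0 (tent_le_one hc w)).trans (hbes w)
  · simp only [tent_eq_zero_of_lt hc (show c + |s| < _ by linarith), zero_mul,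
      Finset.sum_const_zero]

variable [CompleteSpace H]

lemma exists_corr_operator (M : ℤ) (β : ℝ) (hc : 0 < c) (U : ℤ × ℤ → H →ₗᵢ[ℝ] H) (f : H) (s : ℝ) :
    ∃ A : H →L[ℝ] H, ∀ g h, ⟪A g, h⟫ = corr M β c U f s g h := by
  let B : H →ₗ⋆[ℝ] H →ₗ[ℝ] ℝ := LinearMap.mk₂'ₛₗ (starRingEnd ℝ) (RingHom.id ℝ)
    (corr M β c U f s)
    (fun g g' h => by rw [corr_comm, corr_add_right M hc, corr_comm, corr_comm M h g'])
    (fun a g h => by rw [corr_comm, corr_smul_right M hc, corr_comm]; simp)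
    (fun g h h' => corr_add_right M hc g h h')
    (fun a g h => by rw [corr_smul_right M hc]; simp)
  refine ⟨InnerProductSpace.continuousLinearMapOfBilin
    (B.mkContinuous₂ (‖f‖ ^ 2 * (2 * (c + |s|) + 1)) fun g h => ?_), fun g h => ?_⟩
  · refine (abs_corr_le M hc le_rfl g h).trans (le_of_eq ?_)
    ring
  · rw [InnerProductSpace.continuousLinearMapOfBilin_apply]
    rfl

/-- The range of a correlation operator consists of almost periodic vectors. -/
lemma almostPeriodic_of_corr (hU : IsRep U) (M : ℤ) (hc : 0 < c) {A : H →L[ℝ] H}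
    (hA : ∀ g h, ⟪A g, h⟫ = corr M β c U f 0 g h) (g : H) :
    AlmostPeriodic U (Lam β 1) (A g) := by
  choose B hB using exists_corr_operator M β hc U f
  have hAB : ∀ v : ℤ × ℤ, U v (A g) = B ((v.2 : ℝ) - β * v.1) (U v g) := fun v => by
    refine ext_inner_right ℝ fun h => ?_
    have : U v (U (-v) h) = h := by rw [← hU.add, add_neg_cancel, hU.zero]
    rw [hU.inner_map_left, hA, hB, ← corr_map hU M hc v g, this, zero_add]
  set K : ℝ := 2 * (c + 1 / 2) + 1
  have hK : 0 < K := by positivity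
  have hLip : ∀ s s' : ℝ, |s| ≤ 1 / 2 → |s'| ≤ 1 / 2 → ∀ x,
      dist (B s x) (B s' x) ≤ |s - s'| * (‖f‖ ^ 2 * ‖x‖ * K / c) := fun s s' hs hs' x => by
    rw [dist_eq_norm]
    set y := B s x - B s' x
    have h1 : ‖y‖ * ‖y‖ = corr M β c U f s x y - corr M β c U f s' x y := by
      rw [← hB, ← hB, ← inner_sub_left, real_inner_self_eq_norm_mul_norm]
    have h2 : ‖y‖ * ‖y‖ ≤ (|s - s'| * (‖f‖ ^ 2 * ‖x‖ * K / c)) * ‖y‖ := by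
      rw [h1]
      refine (le_abs_self _).trans ((abs_corr_sub_corr_le M hc s' hs hs' x y).trans (le_of_eq ?_))
      ring
    rcases (norm_nonneg y).eq_or_lt with h | h
    · rw [← h]; positivity
    · exact le_of_mul_le_mul_right h2 h
  have hBtb : ∀ s : ℝ, |s| ≤ 1 / 2 → TotallyBounded (B s '' Metric.closedBall 0 (‖g‖ + 1)) := by
    intro s hs
    set C : ℝ := ‖f‖ ^ 2 * K + 1
    have hC : 0 < C := by positivity
    refine totallyBounded_image_of_trace_le (B s) hC (fun x => ?_) (fun t ht => ?_) (by positivity)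
    · have h1 := corr_le (U := U) (β := β) (f := f) (s := s) M hc hC x (B s x)
      have h2 := (le_abs_self _).trans
        (abs_corr_le (U := U) (β := β) (f := f) M hc hs (B s x) (B s x))
      have h3 : corr M β c U f s (B s x) (B s x) ≤ C * ‖B s x‖ ^ 2 := by
        have : C * ‖B s x‖ ^ 2 = ‖f‖ * ‖B s x‖ * (‖f‖ * ‖B s x‖) * K + ‖B s x‖ ^ 2 := by
          simp only [C]; ring
        rw [this]
        exact h2.trans (le_add_of_nonneg_right (sq_nonneg _))
      rw [← hB, ← hB, real_inner_self_eq_norm_sq] at h1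
      have h4 : 1 / (2 * C) * corr M β c U f s (B s x) (B s x) ≤
          1 / (2 * C) * (C * ‖B s x‖ ^ 2) := by gcongr
      have h5 : 1 / (2 * C) * (C * ‖B s x‖ ^ 2) = ‖B s x‖ ^ 2 / 2 := by field_simp
      linarith
    · simp only [hB]
      exact (sum_corr_le M hc hs t ht).trans (le_add_of_nonneg_right zero_le_one)
  refine totallyBounded_of_forall_approx fun ε hε => ?_
  set D : ℝ := ‖f‖ ^ 2 * ‖g‖ * K / c
  have hD : 0 ≤ D := by positivity
  obtain ⟨t, ht, hfin, hcov⟩ := Metric.finite_approx_of_totallyBounded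
    (totallyBounded_Icc (-(1 / 2) : ℝ) (1 / 2)) (ε / (D + 1)) (by positivity)
  refine ⟨⋃ y ∈ t, B y '' Metric.closedBall 0 (‖g‖ + 1),
    (totallyBounded_biUnion hfin).2 fun y hy => hBtb y (abs_le.2 (ht hy)), ?_⟩
  rintro _ ⟨v, hv, rfl⟩
  have hv' : (v.2 : ℝ) - β * v.1 ∈ Icc (-(1 / 2) : ℝ) (1 / 2) :=
    ⟨by linarith [hv.1], by linarith [hv.2]⟩
  obtain ⟨y, hy, hvy⟩ := mem_iUnion₂.1 (hcov hv')
  refine ⟨B y (U v g), mem_iUnion₂.2 ⟨y, hy, _, ?_, rfl⟩, ?_⟩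
  · rw [mem_closedBall_zero_iff, (U v).norm_map]; linarith
  · rw [Metric.mem_ball, Real.dist_eq, lt_div_iff₀ (by positivity)] at hvy
    have := hLip _ y (abs_le.2 hv') (abs_le.2 (ht hy)) (U v g)
    rw [(U v).norm_map] at this
    simp only [hAB]
    refine this.trans_lt (lt_of_le_of_lt ?_ hvy)
    gcongr
    linarith

/-- Vectors orthogonal to all almost periodic vectors have vanishing mean correlations. -/
lemma corr_self_eq_zero (hU : IsRep U) (M : ℤ) (hc : 0 < c)
    (hf : ∀ k, AlmostPeriodic U (Lam β 1) k → ⟪f, k⟫ = 0) (g : H) :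
    corr M β c U f 0 g g = 0 := by
  obtain ⟨A, hA⟩ := exists_corr_operator M β hc U f 0
  have hAP := almostPeriodic_of_corr hU M hc hA g
  have h0 : ⟪A g, A g⟫ = 0 := by
    have : ∀ w, ⟪U w f, A g⟫ = 0 := fun w => by
      rw [hU.inner_map_left]; exact hf _ (hAP.map hU _)
    rw [hA, corr]
    simp only [this, mul_zero, stripMean_zero]
  rw [← hA, inner_self_eq_zero.1 h0, inner_zero_left]

/-- Finitely many vectors orthogonal to the almost periodic vectors can be simultaneously
almost decorrelated from finitely many vectors by an element of the strip. -/
theorem exists_forall_abs_inner_lt (hU : IsRep U) (M : ℤ) (β : ℝ) {b : ℝ} (hb : 0 < b)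
    {F G : Finset H} (hF : ∀ f ∈ F, ∀ k, AlmostPeriodic U (Lam β 1) k → ⟪f, k⟫ = 0)
    {ε : ℝ} (hε : 0 < ε) :
    ∃ w ∈ Lam β b, M < w.1 ∧ ∀ f ∈ F, ∀ g ∈ G, |⟪U w f, g⟫| < ε := by
  by_contra! hcon
  have hc : 0 < b / 2 := half_pos hb
  have hz : stripMean M (fun w => ∑ f ∈ F, ∑ g ∈ G,
      tent β (b / 2) 0 w * (⟪U w f, g⟫ * ⟪U w f, g⟫)) = 0 := by
    rw [stripMean_sum (β := β) M F fun f _ => StripBdd.sum G fun g _ => stripBdd_corr hc g g]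
    refine Finset.sum_eq_zero fun f hf => ?_
    rw [stripMean_sum (β := β) M G fun g _ => stripBdd_corr hc g g]
    exact Finset.sum_eq_zero fun g _ => corr_self_eq_zero hU M hc (hF f hf) g
  have hle : stripMean M (fun w => ε ^ 2 * tent β (b / 2) 0 w) ≤ 0 := by
    refine le_trans ?_ hz.le
    refine stripMean_mono (β := β) ((stripBdd_tent hc).const_mul _)
      (StripBdd.sum F fun f _ => StripBdd.sum G fun g _ => stripBdd_corr hc g g) fun w hw => ?_
    have hnn : ∀ f g, 0 ≤ tent β (b / 2) 0 w * (⟪U w f, g⟫ * ⟪U w f, g⟫) := fun f g =>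
      mul_nonneg (tent_nonneg w) (mul_self_nonneg _)
    by_cases hwL : w ∈ Lam β b
    · obtain ⟨f, hf, g, hg, hfg⟩ := hcon w hwL hw
      have h1 : ε ^ 2 ≤ ⟪U w f, g⟫ * ⟪U w f, g⟫ := by
        rw [← sq, ← sq_abs ⟪U w f, g⟫]; gcongr
      calc ε ^ 2 * tent β (b / 2) 0 w
          ≤ tent β (b / 2) 0 w * (⟪U w f, g⟫ * ⟪U w f, g⟫) := by
            rw [mul_comm]; exact mul_le_mul_of_nonneg_left h1 (tent_nonneg w)
        _ ≤ ∑ g ∈ G, tent β (b / 2) 0 w * (⟪U w f, g⟫ * ⟪U w f, g⟫) :=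
          Finset.single_le_sum (f := fun g => tent β (b / 2) 0 w * (⟪U w f, g⟫ * ⟪U w f, g⟫))
            (fun g _ => hnn f g) hg
        _ ≤ _ := Finset.single_le_sum
          (f := fun f => ∑ g ∈ G, tent β (b / 2) 0 w * (⟪U w f, g⟫ * ⟪U w f, g⟫))
            (fun f _ => Finset.sum_nonneg fun g _ => hnn f g) hf
    · have h0 : tent β (b / 2) 0 w = 0 := by
        refine tent_eq_zero hc ?_
        rw [sub_zero]
        by_contra! hlt
        have := abs_lt.1 hlt
        exact hwL ⟨by linarith, by linarith⟩
      simp only [h0, mul_zero, zero_mul, Finset.sum_const_zero, le_refl]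
  rw [stripMean_const_mul M (stripBdd_tent hc)] at hle
  have := mul_pos (pow_pos hε 2) (stripMean_tent_pos (β := β) M hc)
  linarith

end corr

end Hilbert

/-! ### The Koopman representation and the directional Kronecker algebra -/

section Koopman

variable {X : Type*} [MeasurableSpace X] {μ : Measure X}
  {T : ℤ × ℤ → X → X} {β : ℝ} {Λ : Set (ℤ × ℤ)} {A B : Set X}

/-- The Koopman operators `U_T^w` on `L²(μ)`. -/
noncomputable def koopman (hT : ∀ w, MeasurePreserving (T w) μ μ) (w : ℤ × ℤ) :
    Lp ℝ 2 μ →ₗᵢ[ℝ] Lp ℝ 2 μ :=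
  Lp.compMeasurePreservingₗᵢ ℝ (T w) (hT w)

variable (hT : ∀ w, MeasurePreserving (T w) μ μ)

lemma coeFn_koopman (w : ℤ × ℤ) (f : Lp ℝ 2 μ) : koopman hT w f =ᵐ[μ] f ∘ T w :=
  Lp.coeFn_compMeasurePreserving f (hT w)

lemma koopman_eq {w : ℤ × ℤ} {f g : Lp ℝ 2 μ} (h : (g : X → ℝ) =ᵐ[μ] f ∘ T w) :
    koopman hT w f = g :=
  Lp.ext ((coeFn_koopman hT w f).trans h.symm)

lemma isRep_koopman (h0 : T 0 = _root_.id) (hadd : ∀ v w, T (v + w) = T v ∘ T w) :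
    IsRep (koopman hT) where
  zero f := koopman_eq hT (by rw [h0]; rfl)
  add v w f := koopman_eq hT <| by
    rw [add_comm, hadd]
    exact (coeFn_koopman hT v _).trans
      ((hT v).quasiMeasurePreserving.ae_eq_comp (coeFn_koopman hT w f))

lemma dirKronAlg_le : dirKronAlg μ T β ≤ ‹MeasurableSpace X› :=
  MeasurableSpace.generateFrom_le fun _ h => h.1

lemma AlmostPeriodic.of_tendsto {hT : ∀ w, MeasurePreserving (T w) μ μ} {f : Lp ℝ 2 μ}
    {F : ℕ → Lp ℝ 2 μ} (hF : ∀ n, AlmostPeriodic (koopman hT) Λ (F n))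
    (h : Tendsto F atTop (𝓝 f)) : AlmostPeriodic (koopman hT) Λ f :=
  of_forall_approx fun ε hε => by
    obtain ⟨n, hn⟩ := ((Metric.tendsto_nhds.1 h) ε hε).exists
    exact ⟨F n, hF n, by rwa [dist_comm]⟩

lemma AlmostPeriodic.compLp {hT : ∀ w, MeasurePreserving (T w) μ μ} {f : Lp ℝ 2 μ}
    (hf : AlmostPeriodic (koopman hT) Λ f) {g : ℝ → ℝ} {c : NNReal}
    (hg : LipschitzWith c g) (g0 : g 0 = 0) :
    AlmostPeriodic (koopman hT) Λ (hg.compLp g0 f) := by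
  refine of_uniformContinuous_map hf (hg.lipschitzWith_compLp g0).uniformContinuous fun w => ?_
  refine koopman_eq hT ?_
  filter_upwards [hg.coeFn_compLp g0 (koopman hT w f), coeFn_koopman hT w f,
    (hT w).quasiMeasurePreserving.ae_eq_comp (hg.coeFn_compLp g0 f)] with x h1 h2 h3
  rw [h1, h3, Function.comp_apply, h2]
  rfl

variable [IsProbabilityMeasure μ]

variable (μ) in
/-- The indicator function of `A`, as an element of `L²(μ)`. -/
noncomputable def indL2 (hA : MeasurableSet A) : Lp ℝ 2 μ :=
  indicatorConstLp 2 hA (measure_ne_top μ A) 1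

lemma coeFn_indL2 (hA : MeasurableSet A) : indL2 μ hA =ᵐ[μ] A.indicator fun _ => 1 :=
  indicatorConstLp_coeFn

lemma tendsto_Lp_of_abs_sub_le_one {F : ℕ → Lp ℝ 2 μ} {f : Lp ℝ 2 μ}
    (hb : ∀ n, ∀ᵐ x ∂μ, |F n x - f x| ≤ 1)
    (h : ∀ᵐ x ∂μ, Tendsto (fun n => F n x) atTop (𝓝 (f x))) : Tendsto F atTop (𝓝 f) := by
  have key : ∀ n, ‖F n - f‖ ^ 2 = ∫ x, (F n x - f x) ^ 2 ∂μ := fun n => by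
    rw [← real_inner_self_eq_norm_sq, L2.inner_def]
    refine integral_congr_ae ?_
    filter_upwards [Lp.coeFn_sub (F n) f] with x hx
    rw [hx, Pi.sub_apply, real_inner_self_eq_norm_sq, Real.norm_eq_abs, sq_abs]
  have hlim : Tendsto (fun n => ‖F n - f‖ ^ 2) atTop (𝓝 0) := by
    simp_rw [key]
    have := tendsto_integral_of_dominated_convergence (μ := μ)
      (F := fun n x => (F n x - f x) ^ 2) (f := fun _ => (0 : ℝ)) (fun _ => 1) (fun n =>
        (((Lp.stronglyMeasurable (F n)).sub (Lp.stronglyMeasurable f)).pow 2).aestronglyMeasurable)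
      (integrable_const _) (fun n => ?_) ?_
    · simpa using this
    · filter_upwards [hb n] with x hx
      rw [Real.norm_eq_abs, abs_pow]
      exact pow_le_one₀ (abs_nonneg _) hx
    · filter_upwards [h] with x hx
      simpa using (hx.sub_const (f x)).pow 2
  rw [tendsto_iff_norm_sub_tendsto_zero]
  simpa [Real.sqrt_sq (norm_nonneg _)] using hlim.sqrt

namespace AlmostPeriodic

variable {hT} {f : Lp ℝ 2 μ}

lemma indL2_univ : AlmostPeriodic (koopman hT) Λ (indL2 μ MeasurableSet.univ) := by
  refine (Metric.totallyBounded_iff.2 fun ε hε => ?_ :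
    TotallyBounded {indL2 μ MeasurableSet.univ}).subset ?_
  · exact ⟨_, finite_singleton (indL2 μ MeasurableSet.univ), by simpa using hε⟩
  · rintro _ ⟨w, -, rfl⟩
    refine mem_singleton_iff.2 (koopman_eq hT ?_)
    filter_upwards [coeFn_indL2 (μ := μ) MeasurableSet.univ,
      (hT w).quasiMeasurePreserving.ae_eq_comp (coeFn_indL2 (μ := μ) MeasurableSet.univ)]
      with x h1 h2
    rw [h1, h2]
    simp

lemma indL2_empty : AlmostPeriodic (koopman hT) Λ (indL2 μ MeasurableSet.empty) := by
  have h := (indL2_univ (hT := hT) (Λ := Λ)).smul 0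
  rw [zero_smul] at h
  convert h
  refine Lp.ext ?_
  filter_upwards [coeFn_indL2 (μ := μ) MeasurableSet.empty, Lp.coeFn_zero ℝ 2 μ] with x h1 h2
  rw [h1, h2]
  simp

lemma indL2_compl {hA : MeasurableSet A} (h : AlmostPeriodic (koopman hT) Λ (indL2 μ hA)) :
    AlmostPeriodic (koopman hT) Λ (indL2 μ hA.compl) := by
  convert indL2_univ.sub h
  refine Lp.ext ?_
  filter_upwards [coeFn_indL2 (μ := μ) hA, coeFn_indL2 (μ := μ) hA.compl,
    coeFn_indL2 (μ := μ) MeasurableSet.univ,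
    Lp.coeFn_sub (indL2 μ MeasurableSet.univ) (indL2 μ hA)] with x h1 h2 h3 h4
  rw [h4, Pi.sub_apply, h1, h2, h3]
  by_cases hx : x ∈ A <;> simp [hx]

lemma indL2_union {hA : MeasurableSet A} {hB : MeasurableSet B}
    (h : AlmostPeriodic (koopman hT) Λ (indL2 μ hA))
    (h' : AlmostPeriodic (koopman hT) Λ (indL2 μ hB)) :
    AlmostPeriodic (koopman hT) Λ (indL2 μ (hA.union hB)) := by
  have hL : LipschitzWith 1 fun x : ℝ => min x 1 := LipschitzWith.id.min_const 1
  convert (h.add h').compLp hL (by simp)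
  refine Lp.ext ?_
  filter_upwards [coeFn_indL2 (μ := μ) hA, coeFn_indL2 (μ := μ) hB,
    coeFn_indL2 (μ := μ) (hA.union hB), Lp.coeFn_add (indL2 μ hA) (indL2 μ hB),
    hL.coeFn_compLp (by simp) (indL2 μ hA + indL2 μ hB)] with x h1 h2 h3 h4 h5
  rw [h5, Function.comp_apply, h4, Pi.add_apply, h1, h2, h3]
  by_cases hx : x ∈ A <;> by_cases hx' : x ∈ B <;> simp [hx, hx']

lemma indL2_iUnion {A : ℕ → Set X} (hA : ∀ n, MeasurableSet (A n))
    (h : ∀ n, AlmostPeriodic (koopman hT) Λ (indL2 μ (hA n))) :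
    AlmostPeriodic (koopman hT) Λ (indL2 μ (MeasurableSet.iUnion hA)) := by
  have hm : ∀ n, MeasurableSet (accumulate A n) := fun n => by
    rw [accumulate_def]
    exact MeasurableSet.biUnion (to_countable _) fun i _ => hA i
  refine of_tendsto (F := fun n => indL2 μ (hm n)) (fun n => ?_)
    (tendsto_Lp_of_abs_sub_le_one (fun n => ?_) ?_)
  · induction n with
    | zero =>
      convert h 0
      simp
    | succ n ih =>
      convert ih.indL2_union (h (n + 1))
      exact accumulate_succ A n
  · filter_upwards [coeFn_indL2 (μ := μ) (hm n), coeFn_indL2 (μ := μ) (MeasurableSet.iUnion hA)]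
      with x h1 h2
    rw [h1, h2]
    by_cases hx : x ∈ accumulate A n <;> by_cases hx' : x ∈ ⋃ i, A i <;> simp [hx, hx']
  · filter_upwards [ae_all_iff.2 fun n => coeFn_indL2 (μ := μ) (hm n),
      coeFn_indL2 (μ := μ) (MeasurableSet.iUnion hA)] with x h1 h2
    simp_rw [h1, h2]
    rw [← iUnion_accumulate]
    exact monotone_accumulate.tendsto_indicator _ _ _ |>.mono_right (pure_le_nhds _)

/-- Superlevel sets of an almost periodic function are almost periodic. -/
lemma indL2_lt (hf : AlmostPeriodic (koopman hT) Λ f) {t : ℝ} (ht : 0 ≤ t)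
    (hm : MeasurableSet {x | t < f x}) : AlmostPeriodic (koopman hT) Λ (indL2 μ hm) := by
  have hL : ∀ n : ℕ, LipschitzWith n fun x : ℝ => max (min (n * (x - t)) 1) 0 := fun n => by
    refine (LipschitzWith.min_const ?_ 1).max_const 0
    refine LipschitzWith.of_dist_le_mul fun x y => ?_
    rw [Real.dist_eq, Real.dist_eq, ← mul_sub, sub_sub_sub_cancel_right, abs_mul]
    simp
  have hL0 : ∀ n : ℕ, max (min (n * (0 - t)) 1) 0 = 0 := fun n => by
    refine max_eq_right ((min_le_left _ _).trans ?_)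
    nlinarith [n.cast_nonneg (α := ℝ)]
  refine of_tendsto (fun n => hf.compLp (hL n) (hL0 n))
    (tendsto_Lp_of_abs_sub_le_one (fun n => ?_) ?_)
  · filter_upwards [(hL n).coeFn_compLp (hL0 n) f, coeFn_indL2 (μ := μ) hm] with x h1 h2
    rw [h1, h2, Function.comp_apply]
    have h3 : max (min (n * (f x - t)) 1) 0 ≤ 1 := max_le (min_le_right _ _) zero_le_one
    have h4 : 0 ≤ max (min (n * (f x - t)) 1) 0 := le_max_right _ _
    rw [abs_le]
    by_cases hx : x ∈ {x | t < f x} <;> simp only [hx, indicator_of_mem, not_false_eq_true,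
      indicator_of_notMem] <;> constructor <;> linarith
  · filter_upwards [ae_all_iff.2 fun n => (hL n).coeFn_compLp (hL0 n) f,
      coeFn_indL2 (μ := μ) hm] with x h1 h2
    simp_rw [h1, h2, Function.comp_apply]
    by_cases hx : t < f x
    · rw [indicator_of_mem (by exact hx)]
      refine tendsto_const_nhds.congr' ?_
      obtain ⟨N, hN⟩ := exists_nat_gt (1 / (f x - t))
      filter_upwards [eventually_ge_atTop N] with n hn
      have h3 : 1 / (f x - t) < n := hN.trans_le (by exact_mod_cast hn)
      rw [div_lt_iff₀ (by linarith)] at h3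
      rw [min_eq_right h3.le, max_eq_left zero_le_one]
    · rw [indicator_of_notMem (by exact hx)]
      refine tendsto_const_nhds.congr fun n => (max_eq_right ((min_le_left _ _).trans ?_)).symm
      nlinarith [n.cast_nonneg (α := ℝ), not_lt.1 hx]

end AlmostPeriodic

lemma mem_dirKron_iff (hB : MeasurableSet B) :
    B ∈ dirKron μ T β 1 ↔ AlmostPeriodic (koopman hT) (Lam β 1) (indL2 μ hB) := by
  have horb : korbit μ T (Lam β 1) B = (fun w => koopman hT w (indL2 μ hB)) '' Lam β 1 := by
    ext g
    simp only [korbit, mem_ofPred_eq, mem_image]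
    refine exists_congr fun w => and_congr_right fun _ => ?_
    have h := (coeFn_koopman hT w _).trans
      ((hT w).quasiMeasurePreserving.ae_eq_comp (coeFn_indL2 (μ := μ) hB))
    exact ⟨fun hg => Lp.ext (h.trans hg.symm), fun hg => hg ▸ h⟩
  rw [dirKron, mem_ofPred_eq, horb, AlmostPeriodic]
  exact ⟨fun h => h.2.totallyBounded.subset subset_closure,
    fun h => ⟨hB, h.closure.isCompact_of_isClosed isClosed_closure⟩⟩

lemma almostPeriodic_of_measurableSet_dirKronAlg (hB : MeasurableSet[dirKronAlg μ T β] B) :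
    AlmostPeriodic (koopman hT) (Lam β 1) (indL2 μ (dirKronAlg_le B hB)) := by
  induction B, hB using MeasurableSpace.generateFrom_induction with
  | hC B hB _ => exact (mem_dirKron_iff hT hB.1).1 hB
  | empty => exact AlmostPeriodic.indL2_empty
  | compl B hB ih => exact ih.indL2_compl
  | iUnion s hs ih => exact AlmostPeriodic.indL2_iUnion _ ih

lemma AlmostPeriodic.aestronglyMeasurable {hT : ∀ w, MeasurePreserving (T w) μ μ} {f : Lp ℝ 2 μ}
    (hf : AlmostPeriodic (koopman hT) (Lam β 1) f) :
    AEStronglyMeasurable[dirKronAlg μ T β] (f : X → ℝ) μ := by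
  have hpos : ∀ {g : Lp ℝ 2 μ}, AlmostPeriodic (koopman hT) (Lam β 1) g →
      Measurable[dirKronAlg μ T β] fun x => max (g x) 0 := fun {g} hg => by
    refine measurable_of_Ioi fun t => ?_
    rcases lt_or_ge t 0 with ht | ht
    · convert MeasurableSet.univ
      exact eq_univ_of_forall fun x => ht.trans_le (le_max_right _ _)
    · have hm : MeasurableSet {x | t < g x} :=
        measurableSet_lt measurable_const (Lp.stronglyMeasurable g).measurable
      have he : (fun x => max (g x) 0) ⁻¹' Ioi t = {x | t < g x} :=
        ext fun x => lt_max_iff.trans (or_iff_left ht.not_gt)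
      rw [he]
      exact MeasurableSpace.measurableSet_generateFrom
        ((mem_dirKron_iff hT hm).2 (hg.indL2_lt ht hm))
  refine ⟨_, ((hpos hf).sub (hpos hf.neg)).stronglyMeasurable, ?_⟩
  filter_upwards [Lp.coeFn_neg f] with x hx
  rw [Pi.sub_apply, hx, Pi.neg_apply]
  rcases le_total (f x) 0 with h | h <;> simp [h]

lemma almostPeriodic_of_mem_lpMeas {f : Lp ℝ 2 μ} (hf : f ∈ lpMeas ℝ ℝ (dirKronAlg μ T β) 2 μ) :
    AlmostPeriodic (koopman hT) (Lam β 1) f := by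
  rw [mem_lpMeas_iff_aestronglyMeasurable] at hf
  refine Lp.induction_stronglyMeasurable dirKronAlg_le (by simp)
    (AlmostPeriodic (koopman hT) (Lam β 1)) ?_ ?_ ?_ f hf
  · intro c s hs hμs
    convert (almostPeriodic_of_measurableSet_dirKronAlg hT hs).smul c
    refine Lp.ext ?_
    rw [Lp.simpleFunc.coe_indicatorConst]
    filter_upwards [indicatorConstLp_coeFn (p := 2) (hs := dirKronAlg_le s hs)
      (hμs := hμs.ne) (c := c),
      Lp.coeFn_smul c (indL2 μ (dirKronAlg_le s hs)),
      coeFn_indL2 (μ := μ) (dirKronAlg_le s hs)] with x h1 h2 h3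
    rw [h1, h2, Pi.smul_apply, h3]
    by_cases hx : x ∈ s <;> simp [hx]
  · intro f g hf hg _ _ _ h1 h2
    exact h1.add h2
  · refine IsClosed.preimage continuous_subtype_val (isClosed_of_closure_subset
      (s := {f | AlmostPeriodic (koopman hT) (Lam β 1) f}) fun f hf => ?_)
    refine AlmostPeriodic.of_forall_approx fun ε hε => ?_
    exact Metric.mem_closure_iff.1 hf ε hε

variable (μ T β) in
/-- The conditional expectation of `1_A` on the directional Kronecker algebra. -/
noncomputable def kronProj (hA : MeasurableSet A) : Lp ℝ 2 μ :=
  condExpL2 ℝ ℝ (dirKronAlg_le (μ := μ) (T := T) (β := β)) (indL2 μ hA)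

lemma almostPeriodic_kronProj (hA : MeasurableSet A) :
    AlmostPeriodic (koopman hT) (Lam β 1) (kronProj μ T β hA) :=
  almostPeriodic_of_mem_lpMeas hT (Subtype.coe_prop _)

lemma kronProj_ae_eq (hA : MeasurableSet A) :
    kronProj μ T β hA =ᵐ[μ] μ[A.indicator fun _ => (1 : ℝ) | dirKronAlg μ T β] :=
  MemLp.condExpL2_ae_eq_condExp (𝕜 := ℝ) dirKronAlg_le
    (memLp_indicator_const 2 hA 1 (Or.inr (measure_ne_top μ A)))

lemma inner_indL2_sub_kronProj (hA : MeasurableSet A) {k : Lp ℝ 2 μ}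
    (hk : AlmostPeriodic (koopman hT) (Lam β 1) k) :
    inner ℝ (indL2 μ hA - kronProj μ T β hA) k = 0 :=
  haveI : Fact (dirKronAlg μ T β ≤ ‹MeasurableSpace X›) := ⟨dirKronAlg_le⟩
  Submodule.starProjection_inner_eq_zero (K := lpMeas ℝ ℝ (dirKronAlg μ T β) 2 μ) _ _
    (mem_lpMeas_iff_aestronglyMeasurable.2 hk.aestronglyMeasurable)

end Koopman

/-! ### Estimates for `negMulLog` -/

section Entropy

open Real

lemma negMulLog_le_of_pos {x c : ℝ} (hx : 0 ≤ x) (hc : 0 < c) :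
    negMulLog x ≤ -x * log c + (c - x) := by
  rcases hx.eq_or_lt with rfl | hx
  · simpa using hc.le
  · have h := mul_le_mul_of_nonneg_left (log_le_sub_one_of_pos (div_pos hc hx)) hx.le
    rw [log_div hc.ne' hx.ne', mul_sub, mul_sub, mul_div_cancel₀ _ hx.ne'] at h
    rw [negMulLog]
    linarith

lemma negMulLog_sum_le {ι : Type*} (s : Finset ι) {f : ι → ℝ} (hf : ∀ i ∈ s, 0 ≤ f i) :
    negMulLog (∑ i ∈ s, f i) ≤ ∑ i ∈ s, negMulLog (f i) := by
  rw [negMulLog, ← Finset.sum_neg_distrib, Finset.sum_mul]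
  refine Finset.sum_le_sum fun i hi => ?_
  rcases (hf i hi).eq_or_lt with h | h
  · simp [← h]
  · have := log_le_log h (Finset.single_le_sum hf hi)
    rw [negMulLog]
    nlinarith

/-- Subadditivity of entropy, for unnormalised weights. -/
lemma sum_negMulLog_add_le {ι κ : Type*} (s : Finset ι) (t : Finset κ) {p : ι → κ → ℝ}
    (hp : ∀ i ∈ s, ∀ j ∈ t, 0 ≤ p i j) :
    ∑ i ∈ s, ∑ j ∈ t, negMulLog (p i j) + negMulLog (∑ i ∈ s, ∑ j ∈ t, p i j) ≤
      ∑ i ∈ s, negMulLog (∑ j ∈ t, p i j) + ∑ j ∈ t, negMulLog (∑ i ∈ s, p i j) := by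
  set P := ∑ i ∈ s, ∑ j ∈ t, p i j with hP
  set r : ι → ℝ := fun i => ∑ j ∈ t, p i j
  set c : κ → ℝ := fun j => ∑ i ∈ s, p i j
  have hr : ∀ i ∈ s, 0 ≤ r i := fun i hi => Finset.sum_nonneg fun j hj => hp i hi j hj
  have hc : ∀ j ∈ t, 0 ≤ c j := fun j hj => Finset.sum_nonneg fun i hi => hp i hi j hj
  have hP' : P = ∑ j ∈ t, c j := Finset.sum_comm
  have key : ∀ i ∈ s, ∀ j ∈ t, negMulLog (p i j) ≤
      -(p i j * log (r i)) - p i j * log (c j) + p i j * log P + (r i * c j / P - p i j) := by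
    intro i hi j hj
    have hP0 : 0 ≤ P := Finset.sum_nonneg hr
    rcases (hp i hi j hj).eq_or_lt with h | h
    · rw [← h]
      have := div_nonneg (mul_nonneg (hr i hi) (hc j hj)) hP0
      simpa using this
    · have h1 : 0 < r i := h.trans_le (Finset.single_le_sum (f := p i) (hp i hi) hj)
      have h2 : 0 < c j :=
        h.trans_le (Finset.single_le_sum (f := fun i => p i j) (fun i hi => hp i hi j hj) hi)
      have h3 : 0 < P := h1.trans_le (Finset.single_le_sum hr hi)
      refine (negMulLog_le_of_pos h.le (div_pos (mul_pos h1 h2) h3)).trans_eq ?_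
      rw [log_div (by positivity) h3.ne', log_mul h1.ne' h2.ne']
      ring
  have hsum := Finset.sum_le_sum fun i hi => Finset.sum_le_sum (key i hi)
  have e1 : ∑ i ∈ s, ∑ j ∈ t, (-(p i j * log (r i)) - p i j * log (c j) + p i j * log P +
      (r i * c j / P - p i j)) = ∑ i ∈ s, negMulLog (r i) + ∑ j ∈ t, negMulLog (c j) -
      negMulLog P + (P * P / P - P) := by
    have a1 : ∑ i ∈ s, ∑ j ∈ t, p i j * log (r i) = -∑ i ∈ s, negMulLog (r i) := by
      rw [← Finset.sum_neg_distrib]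
      exact Finset.sum_congr rfl fun i _ => by rw [← Finset.sum_mul, negMulLog]; ring
    have a2 : ∑ i ∈ s, ∑ j ∈ t, p i j * log (c j) = -∑ j ∈ t, negMulLog (c j) := by
      rw [Finset.sum_comm, ← Finset.sum_neg_distrib]
      exact Finset.sum_congr rfl fun i _ => by rw [← Finset.sum_mul, negMulLog]; ring
    have a3 : ∑ i ∈ s, ∑ j ∈ t, p i j * log P = -negMulLog P := by
      simp_rw [← Finset.sum_mul]
      rw [negMulLog]; ring
    have a4 : ∑ i ∈ s, ∑ j ∈ t, r i * c j / P = P * P / P := by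
      simp_rw [← Finset.sum_div, ← Finset.mul_sum, ← Finset.sum_mul]
      rw [← hP', ← hP]
    simp only [Finset.sum_add_distrib, Finset.sum_sub_distrib, Finset.sum_neg_distrib, a1, a2, a3,
      a4]
    ring
  rw [e1, mul_self_div_self, sub_self, add_zero] at hsum
  linarith

lemma exists_abs_negMulLog_sub_le {ε : ℝ} (hε : 0 < ε) : ∃ M : ℝ, 0 < M ∧
    ∀ x ∈ Icc (0 : ℝ) 1, ∀ y ∈ Icc (0 : ℝ) 1,
      |negMulLog x - negMulLog y| ≤ ε + M * |x - y| := by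
  obtain ⟨δ, hδ, h⟩ := Metric.uniformContinuousOn_iff.1
    (isCompact_Icc.uniformContinuousOn_of_continuous
      continuous_negMulLog.continuousOn : UniformContinuousOn negMulLog (Icc 0 1)) ε hε
  have hb : ∀ x ∈ Icc (0 : ℝ) 1, 0 ≤ negMulLog x ∧ negMulLog x ≤ 1 := fun x hx =>
    ⟨negMulLog_nonneg hx.1 hx.2, by
      have := negMulLog_le_of_pos hx.1 one_pos
      simp only [log_one, mul_zero, zero_add] at this
      linarith [hx.1]⟩
  refine ⟨1 / δ, by positivity, fun x hx y hy => ?_⟩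
  rcases lt_or_ge |x - y| δ with hxy | hxy
  · have := (h x hx y hy hxy).le
    rw [Real.dist_eq] at this
    have : 0 ≤ 1 / δ * |x - y| := by positivity
    linarith
  · have h1 : 1 ≤ 1 / δ * |x - y| := by
      rw [one_div_mul_eq_div, le_div_iff₀ hδ]; linarith
    have := hb x hx
    have := hb y hy
    rw [abs_le]
    constructor <;> linarith

variable {X : Type*} [MeasurableSpace X] {μ : Measure X} [IsProbabilityMeasure μ]
  {q : X → ℝ} {D : Set X}

lemma integrable_of_mem_Icc (hq : AEStronglyMeasurable q μ) (h : ∀ᵐ x ∂μ, q x ∈ Icc (0 : ℝ) 1) :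
    Integrable q μ :=
  Integrable.of_bound hq 1 (h.mono fun x hx => by
    rw [Real.norm_eq_abs, abs_of_nonneg hx.1]; exact hx.2)

lemma integrable_negMulLog (hq : AEStronglyMeasurable q μ)
    (h : ∀ᵐ x ∂μ, q x ∈ Icc (0 : ℝ) 1) : Integrable (fun x => negMulLog (q x)) μ := by
  refine integrable_of_mem_Icc (continuous_negMulLog.comp_aestronglyMeasurable hq)
    (h.mono fun x hx => ⟨negMulLog_nonneg hx.1 hx.2, ?_⟩)
  have := negMulLog_le_of_pos hx.1 one_pos
  simp only [log_one, mul_zero, zero_add] at this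
  linarith [hx.1]

lemma setIntegral_mem_Icc (hq : AEStronglyMeasurable q μ)
    (h : ∀ᵐ x ∂μ, q x ∈ Icc (0 : ℝ) 1) : (∫ x in D, q x ∂μ) ∈ Icc 0 (μ.real D) := by
  have h' := ae_restrict_of_ae (s := D) h
  refine ⟨integral_nonneg_of_ae (h'.mono fun x hx => hx.1), ?_⟩
  refine (integral_mono_ae (integrable_of_mem_Icc hq h).integrableOn (integrable_const 1)
    (h'.mono fun x hx => hx.2)).trans_eq (by simp)

/-- Jensen's inequality for `negMulLog`. -/
lemma setIntegral_negMulLog_le (hq : AEStronglyMeasurable q μ)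
    (h : ∀ᵐ x ∂μ, q x ∈ Icc (0 : ℝ) 1) :
    ∫ x in D, negMulLog (q x) ∂μ ≤
      negMulLog (∫ x in D, q x ∂μ) + (∫ x in D, q x ∂μ) * log (μ.real D) := by
  set a := ∫ x in D, q x ∂μ with ha
  have ham : a ∈ Icc 0 (μ.real D) := setIntegral_mem_Icc hq h
  have hqi := (integrable_of_mem_Icc hq h).integrableOn (s := D)
  have key : ∀ c > 0, ∫ x in D, negMulLog (q x) ∂μ ≤ -a * log c + (c * μ.real D - a) := by
    intro c hc
    have i1 : IntegrableOn (fun x => -q x * log c) D μ := hqi.neg.mul_const _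
    have i2 : IntegrableOn (fun x => c - q x) D μ := (integrable_const c).sub hqi
    have h1 : ∫ x in D, negMulLog (q x) ∂μ ≤ ∫ x in D, (-q x * log c + (c - q x)) ∂μ :=
      integral_mono_ae (integrable_negMulLog hq h).integrableOn (i1.add i2)
        ((ae_restrict_of_ae h).mono fun x hx => negMulLog_le_of_pos hx.1 hc)
    rwa [integral_add i1 i2,
      integral_mul_const, integral_neg, integral_sub (integrable_const c) hqi, integral_const,
      measureReal_restrict_apply_univ, smul_eq_mul, mul_comm (μ.real D), ← ha] at h1
  rcases ham.1.eq_or_lt with h0 | h0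
  · rw [← h0] at key ⊢
    simp only [negMulLog_zero, zero_mul, add_zero]
    refine le_of_forall_pos_le_add fun ε hε => (key ε hε).trans ?_
    have : μ.real D ≤ 1 := measureReal_le_one
    simp only [neg_zero, zero_mul, sub_zero, zero_add]
    nlinarith
  · have hD : 0 < μ.real D := h0.trans_le ham.2
    refine (key (a / μ.real D) (div_pos h0 hD)).trans_eq ?_
    rw [log_div h0.ne' hD.ne', div_mul_cancel₀ _ hD.ne', negMulLog]
    ring

lemma negMulLog_setIntegral_le (hq : AEStronglyMeasurable q μ)
    (h : ∀ᵐ x ∂μ, q x ∈ Icc (0 : ℝ) 1) {ε M : ℝ} (hM : 0 ≤ M) (hη : ∀ x ∈ Icc (0 : ℝ) 1,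
      ∀ y ∈ Icc (0 : ℝ) 1, |negMulLog x - negMulLog y| ≤ ε + M * |x - y|) (v : ℝ) :
    negMulLog (∫ x in D, q x ∂μ) + (∫ x in D, q x ∂μ) * log (μ.real D) ≤
      ∫ x in D, negMulLog (q x) ∂μ + ε * μ.real D + 2 * M * ∫ x in D, |q x - v| ∂μ := by
  set a := ∫ x in D, q x ∂μ with ha
  set m := μ.real D with hm
  set b := ∫ x in D, |q x - v| ∂μ with hb
  have ham : a ∈ Icc 0 m := setIntegral_mem_Icc hq h
  have hqi := (integrable_of_mem_Icc hq h).integrableOn (s := D)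
  have hηi := (integrable_negMulLog hq h).integrableOn (s := D)
  have hci : ∀ c : ℝ, IntegrableOn (fun _ => c) D μ := fun c => integrable_const c
  have hvi : ∀ c : ℝ, IntegrableOn (fun x => |q x - c|) D μ := fun c => (hqi.sub (hci c)).abs
  rcases (ham.1.trans ham.2).eq_or_lt with h0 | h0
  · have hD0 : μ.restrict D = 0 := Measure.restrict_eq_zero.2 ((measureReal_eq_zero_iff).1 h0.symm)
    simp [ha, hb, hD0, ← h0]
  · have hc : a / m ∈ Icc (0 : ℝ) 1 := ⟨div_nonneg ham.1 h0.le, div_le_one_of_le₀ ham.2 h0.le⟩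
    have e1 : negMulLog a + a * log m = m * negMulLog (a / m) := by
      rcases ham.1.eq_or_lt with h1 | h1
      · simp [← h1]
      · rw [negMulLog, negMulLog, log_div h1.ne' h0.ne']
        field_simp
        ring
    have e2 : m * negMulLog (a / m) ≤ ∫ x in D, negMulLog (q x) ∂μ + ε * m +
        M * ∫ x in D, |q x - a / m| ∂μ := by
      have i1 : IntegrableOn (fun x => M * |q x - a / m|) D μ := (hvi _).const_mul M
      have i2 : IntegrableOn (fun x => ε + M * |q x - a / m|) D μ := (hci ε).add i1
      have h1 : ∫ _ in D, negMulLog (a / m) ∂μ ≤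
          ∫ x in D, (negMulLog (q x) + (ε + M * |q x - a / m|)) ∂μ := by
        refine integral_mono_ae (hci _) (hηi.add i2)
          ((ae_restrict_of_ae h).mono fun x hx => ?_)
        have := hη _ hc _ hx
        rw [abs_sub_comm (a / m)] at this
        have := le_abs_self (negMulLog (a / m) - negMulLog (q x))
        simp only
        linarith
      rw [integral_add hηi i2, integral_add (hci ε) i1, integral_const_mul, integral_const,
        integral_const, measureReal_restrict_apply_univ, smul_eq_mul, smul_eq_mul] at h1
      linarith
    have e3 : ∫ x in D, |q x - a / m| ∂μ ≤ 2 * b := by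
      have h1 : ∫ x in D, |q x - a / m| ∂μ ≤ ∫ x in D, (|q x - v| + |v - a / m|) ∂μ :=
        integral_mono (hvi _) ((hvi v).add (hci _)) fun x => abs_sub_le _ _ _
      rw [integral_add (hvi v) (hci _), integral_const, measureReal_restrict_apply_univ,
        smul_eq_mul] at h1
      have h2 : m * |v - a / m| ≤ b := by
        have h3 : m * (v - a / m) = ∫ x in D, (v - q x) ∂μ := by
          rw [integral_sub (hci v) hqi, integral_const, measureReal_restrict_apply_univ,
            smul_eq_mul, mul_sub, mul_div_cancel₀ _ h0.ne']
        have h4 : m * |v - a / m| = |∫ x in D, (v - q x) ∂μ| := by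
          rw [← h3, abs_mul, abs_of_pos h0]
        rw [h4, hb]
        simp_rw [abs_sub_comm (q _)]
        exact abs_integral_le_integral_abs
      linarith
    rw [e1]
    nlinarith

end Entropy

/-! ### Joins of partitions -/

section Partitions

open Real

variable {X : Type*} [MeasurableSpace X] {μ : Measure X} {G : Type*} {T : G → X → X} {w : ℕ → G}
  {α P : Finset (Set X)} {E : Set X}

lemma isPartition_seqJoin (hT : ∀ w, Measurable (T w)) (hα : IsPartition α) (k : ℕ) :
    IsPartition (seqJoin T w α k) := by
  induction k with
  | zero => exact ⟨by simp [seqJoin], by simp [seqJoin], by simp [seqJoin]⟩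
  | succ k ih =>
    refine ⟨fun E hE => ?_, fun E hE F hF hEF => ?_, eq_univ_of_forall fun x => ?_⟩
    · obtain ⟨p, hp, rfl⟩ := Finset.mem_image.1 hE
      rw [Finset.mem_product] at hp
      exact (ih.1 _ hp.1).inter (hT _ (hα.1 _ hp.2))
    · obtain ⟨p, hp, rfl⟩ := Finset.mem_image.1 hE
      obtain ⟨q, hq, rfl⟩ := Finset.mem_image.1 hF
      rw [Finset.mem_product] at hp hq
      by_cases h1 : p.1 = q.1
      · have h2 : p.2 ≠ q.2 := fun h2 => hEF (by rw [h1, h2])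
        exact ((hα.2.1 hp.2 hq.2 h2).preimage _).mono inter_subset_right inter_subset_right
      · exact (ih.2.1 hp.1 hq.1 h1).mono inter_subset_left inter_subset_left
    · obtain ⟨C, hC, hxC⟩ := mem_sUnion.1 (ih.2.2.symm ▸ mem_univ x)
      obtain ⟨A, hA, hxA⟩ := mem_sUnion.1 (hα.2.2.symm ▸ mem_univ (T (w k) x))
      exact mem_sUnion.2 ⟨_, Finset.mem_image.2 ⟨(C, A), Finset.mem_product.2 ⟨hC, hA⟩, rfl⟩,
        hxC, hxA⟩

lemma sum_seqJoin_succ (hT : ∀ w, Measurable (T w)) (hα : IsPartition α) (k : ℕ)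
    {f : Set X → ℝ} (hf : f ∅ = 0) : ∑ E ∈ seqJoin T w α (k + 1), f E =
      ∑ C ∈ seqJoin T w α k, ∑ A ∈ α, f (C ∩ T (w k) ⁻¹' A) := by
  rw [seqJoin, Finset.sum_image_of_disjoint hf, Finset.sum_product]
  intro p hp q hq hpq
  rw [Finset.mem_coe, Finset.mem_product] at hp hq
  by_cases h1 : p.1 = q.1
  · have h2 : p.2 ≠ q.2 := fun h2 => hpq (Prod.ext h1 h2)
    exact ((hα.2.1 hp.2 hq.2 h2).preimage _).mono inter_subset_right inter_subset_right
  · exact ((isPartition_seqJoin hT hα k).2.1 hp.1 hq.1 h1).mono inter_subset_left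
      inter_subset_left

lemma IsPartition.sum_measureReal_inter_preimage [IsProbabilityMeasure μ] (hP : IsPartition P)
    {f : X → X} (hf : Measurable f) (hE : MeasurableSet E) :
    ∑ A ∈ P, μ.real (E ∩ f ⁻¹' A) = μ.real E := by
  have hd : (P : Set (Set X)).PairwiseDisjoint fun A => E ∩ f ⁻¹' A := fun A hA B hB hAB =>
    ((hP.2.1 hA hB hAB).preimage f).mono inter_subset_right inter_subset_right
  rw [← measureReal_biUnion_finset hd fun A hA => hE.inter (hf (hP.1 A hA))]
  congr 1
  rw [← inter_iUnion₂, inter_eq_left]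
  intro x _
  obtain ⟨A, hA, hxA⟩ := mem_sUnion.1 (hP.2.2.symm ▸ mem_univ (f x))
  exact mem_iUnion₂.2 ⟨A, hA, hxA⟩

lemma IsPartition.sum_measureReal_inter [IsProbabilityMeasure μ] (hP : IsPartition P)
    (hE : MeasurableSet E) : ∑ A ∈ P, μ.real (E ∩ A) = μ.real E :=
  hP.sum_measureReal_inter_preimage measurable_id hE

lemma sum_setIntegral_preimage_singleton {κ : Type*} [Fintype κ] {g : X → κ}
    (hg : ∀ c, MeasurableSet (g ⁻¹' {c})) {q : X → ℝ} (hq : Integrable q μ) :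
    ∑ c, ∫ x in g ⁻¹' {c}, q x ∂μ = ∫ x, q x ∂μ := by
  rw [← integral_iUnion_fintype hg (fun c d hcd => (disjoint_singleton.2 hcd).preimage g)
    fun c => hq.integrableOn, ← preimage_iUnion, iUnion_of_singleton, preimage_univ,
    setIntegral_univ]

variable [IsProbabilityMeasure μ]

lemma partEnt_seqJoin_le_s2 (hT : ∀ w, Measurable (T w)) (hα : IsPartition α) {κ : Type*} [Fintype κ]
    {g : X → κ} (hg : ∀ c, MeasurableSet (g ⁻¹' {c})) {s : ℝ}
    (hs : ∀ i, ∑ c, (∑ A ∈ α, negMulLog (μ.real (g ⁻¹' {c} ∩ T (w i) ⁻¹' A)) -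
      negMulLog (μ.real (g ⁻¹' {c}))) ≤ s) (k : ℕ) :
    partEnt μ (seqJoin T w α k) ≤ ∑ c, negMulLog (μ.real (g ⁻¹' {c})) + k * s := by
  have hjoint : ∑ c, ∑ C ∈ seqJoin T w α k, negMulLog (μ.real (g ⁻¹' {c} ∩ C)) ≤
      ∑ c, negMulLog (μ.real (g ⁻¹' {c})) + k * s := by
    induction k with
    | zero => simp [seqJoin]
    | succ k ih =>
      have hP := isPartition_seqJoin (w := w) hT hα k
      have step : ∀ c, ∑ E ∈ seqJoin T w α (k + 1), negMulLog (μ.real (g ⁻¹' {c} ∩ E)) ≤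
          ∑ C ∈ seqJoin T w α k, negMulLog (μ.real (g ⁻¹' {c} ∩ C)) +
          (∑ A ∈ α, negMulLog (μ.real (g ⁻¹' {c} ∩ T (w k) ⁻¹' A)) -
            negMulLog (μ.real (g ⁻¹' {c}))) := fun c => by
        rw [sum_seqJoin_succ hT hα k (by simp)]
        have h := sum_negMulLog_add_le (seqJoin T w α k) α
          (p := fun C A : Set X => μ.real (g ⁻¹' {c} ∩ (C ∩ T (w k) ⁻¹' A)))
          fun _ _ _ _ => measureReal_nonneg
        have h1 : ∀ C ∈ seqJoin T w α k, ∑ A ∈ α, μ.real (g ⁻¹' {c} ∩ (C ∩ T (w k) ⁻¹' A)) =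
            μ.real (g ⁻¹' {c} ∩ C) := fun C hC => by
          simp_rw [← inter_assoc]
          exact hα.sum_measureReal_inter_preimage (hT _) ((hg c).inter (hP.1 C hC))
        have h2 : ∀ A ∈ α, ∑ C ∈ seqJoin T w α k, μ.real (g ⁻¹' {c} ∩ (C ∩ T (w k) ⁻¹' A)) =
            μ.real (g ⁻¹' {c} ∩ T (w k) ⁻¹' A) := fun A hA => by
          have e : ∀ C, g ⁻¹' {c} ∩ (C ∩ T (w k) ⁻¹' A) = g ⁻¹' {c} ∩ T (w k) ⁻¹' A ∩ C :=
            fun C => by rw [inter_comm C, inter_assoc]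
          simp_rw [e]
          exact hP.sum_measureReal_inter ((hg c).inter (hT _ (hα.1 A hA)))
        rw [Finset.sum_congr rfl h1, hP.sum_measureReal_inter (μ := μ) (hg c),
          Finset.sum_congr rfl fun C hC => congrArg negMulLog (h1 C hC),
          Finset.sum_congr rfl fun A hA => congrArg negMulLog (h2 A hA)] at h
        linarith
      refine (Finset.sum_le_sum fun c _ => step c).trans ?_
      rw [Finset.sum_add_distrib]
      push_cast
      linarith [hs k]
  refine le_trans ?_ hjoint
  rw [partEnt, Finset.sum_comm]
  refine Finset.sum_le_sum fun C hC => ?_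
  have hC' := (isPartition_seqJoin hT hα k).1 C hC
  have h1 : (μ C).toReal = ∑ c, μ.real (g ⁻¹' {c} ∩ C) := by
    have := sum_setIntegral_preimage_singleton (μ := μ) hg
      ((integrable_const (1 : ℝ)).indicator hC')
    simp_rw [integral_indicator hC', Measure.restrict_restrict hC'] at this
    simpa [inter_comm, Measure.real] using this.symm
  rw [h1]
  exact negMulLog_sum_le _ fun _ _ => measureReal_nonneg

end Partitions

/-! ### Entropy relative to the directional Kronecker algebra -/

section KroneckerEntropy

open Real

universe u

variable {X : Type u} [MeasurableSpace X] {μ : Measure X}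
  {T : ℤ × ℤ → X → X} {β : ℝ} {A D : Set X} {α P : Finset (Set X)}

variable (μ T β) in
/-- The conditional probability of `A` given the directional Kronecker algebra. -/
noncomputable def kronProb (A : Set X) : X → ℝ :=
  μ[A.indicator fun _ => (1 : ℝ) | dirKronAlg μ T β]

lemma aestronglyMeasurable_kronProb : AEStronglyMeasurable (kronProb μ T β A) μ :=
  (stronglyMeasurable_condExp.mono dirKronAlg_le).aestronglyMeasurable

lemma integral_negMulLog_kronProb_comp (hT : ∀ w, MeasurePreserving (T w) μ μ) (w : ℤ × ℤ) :
    ∫ x, negMulLog (kronProb μ T β A (T w x)) ∂μ = ∫ x, negMulLog (kronProb μ T β A x) ∂μ := by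
  have h : AEStronglyMeasurable (fun x => negMulLog (kronProb μ T β A x)) (μ.map (T w)) := by
    rw [(hT w).map_eq]
    exact continuous_negMulLog.comp_aestronglyMeasurable aestronglyMeasurable_kronProb
  rw [← integral_map (hT w).aemeasurable h, (hT w).map_eq]

lemma aestronglyMeasurable_kronProb_comp (hT : ∀ w, MeasurePreserving (T w) μ μ) (w : ℤ × ℤ) :
    AEStronglyMeasurable (fun x => kronProb μ T β A (T w x)) μ :=
  aestronglyMeasurable_kronProb.comp_quasiMeasurePreserving (hT w).quasiMeasurePreserving

variable [IsProbabilityMeasure μ]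

lemma integrable_indicator_one (hA : MeasurableSet A) :
    Integrable (A.indicator fun _ => (1 : ℝ)) μ :=
  (integrable_const 1).indicator hA

lemma kronProb_mem_Icc (hA : MeasurableSet A) : ∀ᵐ x ∂μ, kronProb μ T β A x ∈ Icc (0 : ℝ) 1 := by
  have h0 : 0 ≤ᵐ[μ] kronProb μ T β A :=
    condExp_nonneg (ae_of_all _ fun x => indicator_nonneg (fun _ _ => zero_le_one) x)
  have h1 : kronProb μ T β A ≤ᵐ[μ] μ[fun _ => (1 : ℝ) | dirKronAlg μ T β] :=
    condExp_mono (integrable_indicator_one hA) (integrable_const 1)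
      (ae_of_all _ fun x => indicator_le_self' (fun _ _ => zero_le_one) x)
  rw [condExp_const dirKronAlg_le] at h1
  filter_upwards [h0, h1] with x h0 h1 using ⟨h0, h1⟩

lemma sum_kronProb (hα : IsPartition α) : ∀ᵐ x ∂μ, ∑ A ∈ α, kronProb μ T β A x = 1 := by
  have h := condExp_finsetSum (μ := μ) (s := α) (f := fun A => A.indicator fun _ => (1 : ℝ))
    (fun A hA => integrable_indicator_one (hα.1 A hA)) (dirKronAlg μ T β)
  have h1 : ∑ A ∈ α, A.indicator (fun _ => (1 : ℝ)) = fun _ : X => (1 : ℝ) := by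
    ext x
    obtain ⟨A, hA, hxA⟩ := mem_sUnion.1 (hα.2.2.symm ▸ mem_univ x)
    rw [Finset.sum_apply, Finset.sum_eq_single_of_mem A hA, indicator_of_mem hxA]
    intro B hB hBA
    exact indicator_of_notMem (fun hxB => disjoint_left.1 (hα.2.1 hB hA hBA) hxB hxA) _
  rw [h1, condExp_const dirKronAlg_le] at h
  filter_upwards [h] with x hx
  rw [hx, Finset.sum_apply]
  rfl

lemma kronProb_comp_mem_Icc (hT : ∀ w, MeasurePreserving (T w) μ μ) (hA : MeasurableSet A) (w : ℤ × ℤ) :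
    ∀ᵐ x ∂μ, kronProb μ T β A (T w x) ∈ Icc (0 : ℝ) 1 :=
  (hT w).quasiMeasurePreserving.ae (kronProb_mem_Icc hA)

lemma sum_setIntegral_kronProb_comp (hT : ∀ w, MeasurePreserving (T w) μ μ)
    (hα : IsPartition α) (w : ℤ × ℤ) :
    ∑ A ∈ α, ∫ x in D, kronProb μ T β A (T w x) ∂μ = μ.real D := by
  have h : (fun x => ∑ A ∈ α, kronProb μ T β A (T w x)) =ᵐ[μ.restrict D] fun _ => 1 :=
    ae_restrict_of_ae ((hT w).quasiMeasurePreserving.ae (sum_kronProb hα))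
  rw [← integral_finsetSum _ fun A hA => (integrable_of_mem_Icc
    (aestronglyMeasurable_kronProb_comp hT w)
    (kronProb_comp_mem_Icc hT (hα.1 A hA) w)).integrableOn, integral_congr_ae h]
  simp

variable (hT : ∀ w, MeasurePreserving (T w) μ μ)

lemma coeFn_koopman_kronProj (hA : MeasurableSet A) (w : ℤ × ℤ) :
    koopman hT w (kronProj μ T β hA) =ᵐ[μ] fun x => kronProb μ T β A (T w x) :=
  (coeFn_koopman hT w _).trans
    ((hT w).quasiMeasurePreserving.ae_eq_comp (kronProj_ae_eq hA))

lemma inner_koopman_indL2_sub_kronProj (hA : MeasurableSet A) (hD : MeasurableSet D)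
    (w : ℤ × ℤ) : inner ℝ (koopman hT w (indL2 μ hA - kronProj μ T β hA)) (indL2 μ hD) =
      μ.real (D ∩ T w ⁻¹' A) - ∫ x in D, kronProb μ T β A (T w x) ∂μ := by
  have h1 : ∫ x in D, (koopman hT w (indL2 μ hA) : X → ℝ) x ∂μ = μ.real (D ∩ T w ⁻¹' A) := by
    have h : (koopman hT w (indL2 μ hA) : X → ℝ) =ᵐ[μ] (T w ⁻¹' A).indicator fun _ => 1 :=
      (coeFn_koopman hT w _).trans ((hT w).quasiMeasurePreserving.ae_eq_comp (coeFn_indL2 hA))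
    rw [integral_congr_ae (ae_restrict_of_ae h), setIntegral_indicator ((hT w).measurable hA)]
    simp
  rw [map_sub, inner_sub_left, real_inner_comm, real_inner_comm (indL2 μ hD), indL2, indL2,
    L2.inner_indicatorConstLp_one, L2.inner_indicatorConstLp_one,
    integral_congr_ae (ae_restrict_of_ae (coeFn_koopman_kronProj hT hA w))]
  exact congrArg (· - _) h1

/-- Refining a given partition by a suitable translate of `α` raises its entropy almost by the
conditional entropy of `α`. -/
lemma exists_condEntAlg_sub_le (hU : IsRep (koopman hT)) (hα : IsPartition α) (hP : IsPartition P)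
    (M : ℤ) {b : ℝ} (hb : 0 < b) {ε : ℝ} (hε : 0 < ε) :
    ∃ w ∈ Lam β b, M < w.1 ∧ condEntAlg μ (dirKronAlg μ T β) α - ε ≤
      ∑ D ∈ P, ∑ A ∈ α, negMulLog (μ.real (D ∩ T w ⁻¹' A)) - partEnt μ P := by
  classical
  set N : ℝ := (P.card : ℝ) * α.card + 1 with hN
  have hN0 : 0 < N := by positivity
  obtain ⟨L, hL, hη⟩ := exists_abs_negMulLog_sub_le (show 0 < ε / (2 * N) by positivity)
  obtain ⟨w, hw, hwM, hFG⟩ := exists_forall_abs_inner_lt hU M β hb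
    (F := α.attach.image fun A : {A // A ∈ α} => indL2 μ (hα.1 A A.2) - kronProj μ T β (hα.1 A A.2))
    (G := P.attach.image fun D : {D // D ∈ P} => indL2 μ (hP.1 D D.2))
    (fun f hf k hk => by
      obtain ⟨A, -, rfl⟩ := Finset.mem_image.1 hf
      exact inner_indL2_sub_kronProj hT _ hk) (show 0 < ε / (2 * N * L) by positivity)
  refine ⟨w, hw, hwM, ?_⟩
  set a : Set X → Set X → ℝ := fun D A => ∫ x in D, kronProb μ T β A (T w x) ∂μ with ha
  have hclose : ∀ D ∈ P, ∀ A ∈ α,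
      negMulLog (a D A) - ε / N ≤ negMulLog (μ.real (D ∩ T w ⁻¹' A)) := fun D hD A hA => by
    have h1 := hFG _ (Finset.mem_image_of_mem _ (Finset.mem_attach _ ⟨A, hA⟩)) _
      (Finset.mem_image_of_mem _ (Finset.mem_attach _ ⟨D, hD⟩))
    rw [inner_koopman_indL2_sub_kronProj] at h1
    have h2 : a D A ∈ Icc 0 (μ.real D) := setIntegral_mem_Icc
      (aestronglyMeasurable_kronProb_comp hT w) (kronProb_comp_mem_Icc hT (hα.1 A hA) w)
    have h3 := hη (a D A) ⟨h2.1, h2.2.trans measureReal_le_one⟩ (μ.real (D ∩ T w ⁻¹' A))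
      ⟨measureReal_nonneg, measureReal_le_one⟩
    rw [abs_sub_comm (a D A)] at h3
    have h4 : L * |μ.real (D ∩ T w ⁻¹' A) - a D A| ≤ ε / (2 * N) := by
      refine (mul_le_mul_of_nonneg_left h1.le hL.le).trans_eq ?_
      field_simp
    have h5 : ε / (2 * N) + ε / (2 * N) = ε / N := by field_simp; ring
    linarith [le_abs_self (negMulLog (a D A) - negMulLog (μ.real (D ∩ T w ⁻¹' A)))]
  have hsum : ∑ D ∈ P, ∑ A ∈ α, negMulLog (a D A) - ε ≤
      ∑ D ∈ P, ∑ A ∈ α, negMulLog (μ.real (D ∩ T w ⁻¹' A)) := by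
    refine le_trans ?_ (Finset.sum_le_sum fun D hD => Finset.sum_le_sum (hclose D hD))
    simp only [Finset.sum_sub_distrib, Finset.sum_const, nsmul_eq_mul]
    have h6 : (P.card : ℝ) * (α.card * (ε / N)) ≤ ε := by
      rw [← mul_assoc, mul_div_assoc', div_le_iff₀ hN0, hN]
      nlinarith
    linarith
  have hjensen : ∀ D ∈ P, ∑ A ∈ α, ∫ x in D, negMulLog (kronProb μ T β A (T w x)) ∂μ ≤
      ∑ A ∈ α, negMulLog (a D A) - negMulLog (μ.real D) := fun D hD => by
    refine (Finset.sum_le_sum fun A hA => setIntegral_negMulLog_le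
      (aestronglyMeasurable_kronProb_comp hT w)
      (kronProb_comp_mem_Icc hT (hα.1 A hA) w)).trans_eq ?_
    rw [Finset.sum_add_distrib, ← Finset.sum_mul, sum_setIntegral_kronProb_comp hT hα, negMulLog]
    ring
  have hcond : condEntAlg μ (dirKronAlg μ T β) α =
      ∑ D ∈ P, ∑ A ∈ α, ∫ x in D, negMulLog (kronProb μ T β A (T w x)) ∂μ := by
    rw [Finset.sum_comm, condEntAlg]
    refine Finset.sum_congr rfl fun A hA => ?_
    have hi := integrable_negMulLog (aestronglyMeasurable_kronProb_comp (β := β) hT w)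
      (kronProb_comp_mem_Icc hT (hα.1 A hA) w)
    rw [← integral_biUnion_finset P hP.1 hP.2.1 fun D _ => hi.integrableOn]
    refine (integral_negMulLog_kronProb_comp hT w).symm.trans ?_
    have : ⋃ D ∈ P, D = univ := by rw [← hP.2.2, sUnion_eq_biUnion]; rfl
    rw [this, setIntegral_univ]
  have hfin := Finset.sum_le_sum hjensen
  rw [← hcond, Finset.sum_sub_distrib] at hfin
  have : partEnt μ P = ∑ D ∈ P, negMulLog (μ.real D) := rfl
  linarith

lemma integral_abs_sub_le_norm (f g : Lp ℝ 2 μ) : ∫ x, |f x - g x| ∂μ ≤ ‖f - g‖ := by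
  have h := (le_abs_self _).trans
    (abs_real_inner_le_norm (indL2 μ MeasurableSet.univ) |f - g|)
  have h1 : ‖indL2 μ (MeasurableSet.univ (α := X))‖ ≤ 1 := by
    rw [indL2, norm_indicatorConstLp (by simp) (by simp)]
    simp
  rw [indL2, L2.inner_indicatorConstLp_one, setIntegral_univ, norm_abs_eq_norm] at h
  refine le_trans (integral_congr_ae ?_).le
    (h.trans (mul_le_of_le_one_left (norm_nonneg _) h1))
  filter_upwards [Lp.coeFn_abs (f - g), Lp.coeFn_sub f g] with x h1 h2
  rw [h1, h2, Pi.sub_apply]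

lemma measureReal_inter_preimage_eq (hU : IsRep (koopman hT)) (hA : MeasurableSet A)
    (hD : MeasurableSet[dirKronAlg μ T β] D) (w : ℤ × ℤ) :
    μ.real (D ∩ T w ⁻¹' A) = ∫ x in D, kronProb μ T β A (T w x) ∂μ := by
  have h := inner_koopman_indL2_sub_kronProj (β := β) hT hA (dirKronAlg_le D hD) w
  rw [hU.inner_map_left, inner_indL2_sub_kronProj hT hA
    ((almostPeriodic_of_measurableSet_dirKronAlg hT hD).map hU _)] at h
  linarith

/-- Finitely many `[0,1]`-valued almost periodic functions are uniformly close to functions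
constant on the cells of a finite partition into sets of the directional Kronecker algebra. -/
lemma exists_quantization {R : Finset (Lp ℝ 2 μ)}
    (hR : ∀ r ∈ R, AlmostPeriodic (koopman hT) (Lam β 1) r)
    (hR' : ∀ r ∈ R, ∀ᵐ x ∂μ, r x ∈ Icc (0 : ℝ) 1) {δ : ℝ} (hδ : 0 < δ) :
    ∃ (κ : Type u) (_ : Fintype κ) (g : X → κ),
      (∀ c, MeasurableSet[dirKronAlg μ T β] (g ⁻¹' {c})) ∧
      ∀ r ∈ R, ∃ v : κ → ℝ, ∀ᵐ x ∂μ, |r x - v (g x)| ≤ δ := by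
  classical
  obtain ⟨N, hN⟩ := exists_nat_gt (1 / δ)
  have hN0 : (0 : ℝ) < N := (one_div_pos.2 hδ).trans hN
  have hNδ : 1 / (N : ℝ) ≤ δ := by
    rw [div_lt_iff₀ hδ] at hN
    rw [div_le_iff₀ hN0]; linarith
  set F : ℝ → Fin (N + 1) := fun y => ⟨min ⌊N * y⌋₊ N, Nat.lt_succ_of_le (min_le_right _ _)⟩
    with hF
  have hFm : Measurable F := by
    have h1 : Measurable fun n : ℕ => (⟨min n N, Nat.lt_succ_of_le (min_le_right _ _)⟩ :
      Fin (N + 1)) := measurable_from_top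
    exact h1.comp (Nat.measurable_floor.comp (measurable_const_mul _))
  have hms : ∀ r : R, AEStronglyMeasurable[dirKronAlg μ T β] ((r : Lp ℝ 2 μ) : X → ℝ) μ :=
    fun r => (hR r r.2).aestronglyMeasurable
  set g : X → R → Fin (N + 1) := fun x r => F ((hms r).mk _ x) with hg
  have hgm : Measurable[dirKronAlg μ T β] g := by
    refine @measurable_pi_lambda X R _ (dirKronAlg μ T β) _ g fun r => ?_
    exact @Measurable.comp X ℝ (Fin (N + 1)) (dirKronAlg μ T β) _ _ _ _ hFm
      (hms r).stronglyMeasurable_mk.measurable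
  refine ⟨R → Fin (N + 1), inferInstance, g, fun c => hgm (measurableSet_singleton c),
    fun r hr => ⟨fun c => (c ⟨r, hr⟩ : ℕ) / N, ?_⟩⟩
  filter_upwards [(hms ⟨r, hr⟩).ae_eq_mk, hR' r hr] with x h1 h2
  refine le_trans ?_ hNδ
  have h3 : (N : ℝ) * r x ≤ N := mul_le_of_le_one_right hN0.le h2.2
  have h4 : ⌊N * r x⌋₊ ≤ N := Nat.floor_le_of_le h3
  have h5 : ((g x ⟨r, hr⟩ : ℕ) : ℝ) = ⌊N * r x⌋₊ := by
    simp only [hg, hF]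
    rw [← h1, min_eq_left h4]
  rw [h5]
  have h6 := Nat.floor_le (mul_nonneg hN0.le h2.1)
  have h7 := Nat.lt_floor_add_one (N * r x)
  have h8 : r x - ⌊N * r x⌋₊ / (N : ℝ) = (N * r x - ⌊N * r x⌋₊) / N := by
    field_simp
  rw [h8, abs_of_nonneg (div_nonneg (by linarith) hN0.le)]
  exact div_le_div_of_nonneg_right (by linarith) hN0.le

/-- There is a finite partition refining which by any translate of `α` along the strip raises
the entropy by at most slightly more than the conditional entropy of `α`. -/
lemma exists_le_condEntAlg_add (hU : IsRep (koopman hT)) (hα : IsPartition α) {ε : ℝ}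
    (hε : 0 < ε) : ∃ (κ : Type u) (_ : Fintype κ) (g : X → κ), (∀ c, MeasurableSet (g ⁻¹' {c})) ∧
      ∀ w ∈ Lam β 1, ∑ c, (∑ A ∈ α, negMulLog (μ.real (g ⁻¹' {c} ∩ T w ⁻¹' A)) -
        negMulLog (μ.real (g ⁻¹' {c}))) ≤ condEntAlg μ (dirKronAlg μ T β) α + ε := by
  classical
  set n : ℝ := α.card + 1 with hn
  have hn0 : 0 < n := by positivity
  obtain ⟨M, hM, hη⟩ := exists_abs_negMulLog_sub_le (show 0 < ε / (2 * n) by positivity)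
  set δ := ε / (8 * n * M) with hδ
  have hδ0 : 0 < δ := by positivity
  have hnet : ∀ A : {A // A ∈ α}, ∃ t ⊆ (fun w => koopman hT w (kronProj μ T β (hα.1 A A.2))) ''
      Lam β 1, t.Finite ∧ (fun w => koopman hT w (kronProj μ T β (hα.1 A A.2))) '' Lam β 1 ⊆
      ⋃ y ∈ t, Metric.ball y δ := fun A =>
    Metric.finite_approx_of_totallyBounded (almostPeriodic_kronProj hT (hα.1 A A.2)) δ hδ0
  choose t ht htf htc using hnet
  set R : Finset (Lp ℝ 2 μ) := α.attach.biUnion fun A => (htf A).toFinset with hRdef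
  have hR : ∀ r ∈ R, ∃ A : {A // A ∈ α}, ∃ w,
      koopman hT w (kronProj μ T β (hα.1 A A.2)) = r := fun r hr => by
    obtain ⟨A, -, hA⟩ := Finset.mem_biUnion.1 hr
    obtain ⟨w, -, hw⟩ := ht A ((htf A).mem_toFinset.1 hA)
    exact ⟨A, w, hw⟩
  obtain ⟨κ, _, g, hg, hgR⟩ := exists_quantization (β := β) (R := R) hT
    (fun r hr => by
      obtain ⟨A, w, rfl⟩ := hR r hr
      exact (almostPeriodic_kronProj hT (hα.1 A A.2)).map hU w)
    (fun r hr => by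
      obtain ⟨A, w, rfl⟩ := hR r hr
      filter_upwards [coeFn_koopman_kronProj (β := β) hT (hα.1 A A.2) w,
        kronProb_comp_mem_Icc (β := β) hT (hα.1 A A.2) w] with x h1 h2
      rwa [h1]) hδ0
  have hg' : ∀ c, MeasurableSet (g ⁻¹' {c}) := fun c => dirKronAlg_le _ (hg c)
  refine ⟨κ, inferInstance, g, hg', fun w hw => ?_⟩
  have hqm : ∀ A, AEStronglyMeasurable (fun x => kronProb μ T β A (T w x)) μ := fun A =>
    aestronglyMeasurable_kronProb_comp hT w
  have hq : ∀ A ∈ α, ∀ᵐ x ∂μ, kronProb μ T β A (T w x) ∈ Icc (0 : ℝ) 1 := fun A hA =>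
    kronProb_comp_mem_Icc hT (hα.1 A hA) w
  have hv : ∀ A ∈ α, ∃ v : κ → ℝ, Integrable (fun x => |kronProb μ T β A (T w x) - v (g x)|) μ ∧
      ∫ x, |kronProb μ T β A (T w x) - v (g x)| ∂μ ≤ 2 * δ := fun A hA => by
    obtain ⟨r, hr, hrd⟩ := mem_iUnion₂.1 (htc ⟨A, hA⟩ ⟨w, hw, rfl⟩)
    obtain ⟨v, hv⟩ := hgR r (Finset.mem_biUnion.2
      ⟨⟨A, hA⟩, Finset.mem_attach _ _, (htf _).mem_toFinset.2 hr⟩)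
    let _ : MeasurableSpace κ := ⊤
    have hvm : Measurable fun x => v (g x) :=
      measurable_from_top.comp (measurable_to_countable' hg')
    have hi : Integrable (fun x => r x - v (g x)) μ :=
      Integrable.of_bound ((Lp.stronglyMeasurable r).sub hvm.stronglyMeasurable).aestronglyMeasurable
        δ hv
    have hi' : Integrable (fun x => koopman hT w (kronProj μ T β (hα.1 A hA)) x - r x) μ :=
      ((Lp.memLp _).integrable one_le_two).sub ((Lp.memLp r).integrable one_le_two)
    have hae := coeFn_koopman_kronProj (β := β) hT (hα.1 A hA) w
    have hle : ∀ᵐ x ∂μ, |kronProb μ T β A (T w x) - v (g x)| ≤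
        |koopman hT w (kronProj μ T β (hα.1 A hA)) x - r x| + δ := by
      filter_upwards [hae, hv] with x h1 h2
      rw [h1]
      exact (abs_sub_le _ (r x) _).trans (by linarith)
    have hint : Integrable (fun x => |kronProb μ T β A (T w x) - v (g x)|) μ := by
      refine ((hi'.add hi).abs).congr ?_
      filter_upwards [hae] with x h1
      rw [Pi.add_apply, h1, sub_add_sub_cancel]
    have hmono : ∫ x, |kronProb μ T β A (T w x) - v (g x)| ∂μ ≤
        ∫ x, (|koopman hT w (kronProj μ T β (hα.1 A hA)) x - r x| + δ) ∂μ :=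
      integral_mono_ae hint (hi'.abs.add (integrable_const δ)) hle
    refine ⟨v, hint, hmono.trans ?_⟩
    rw [integral_add hi'.abs (integrable_const δ), integral_const, probReal_univ, one_smul]
    have := integral_abs_sub_le_norm (koopman hT w (kronProj μ T β (hα.1 A hA))) r
    rw [Metric.mem_ball, dist_eq_norm] at hrd
    linarith
  choose! v hvi hv using hv
  have hcell : ∀ c, ∑ A ∈ α, negMulLog (μ.real (g ⁻¹' {c} ∩ T w ⁻¹' A)) -
      negMulLog (μ.real (g ⁻¹' {c})) ≤
      ∑ A ∈ α, (∫ x in g ⁻¹' {c}, negMulLog (kronProb μ T β A (T w x)) ∂μ +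
        ε / (2 * n) * (∫ _ in g ⁻¹' {c}, 1 ∂μ) +
        2 * M * ∫ x in g ⁻¹' {c}, |kronProb μ T β A (T w x) - v A (g x)| ∂μ) := fun c => by
    have h1 : ∑ A ∈ α, negMulLog (μ.real (g ⁻¹' {c} ∩ T w ⁻¹' A)) -
        negMulLog (μ.real (g ⁻¹' {c})) =
        ∑ A ∈ α, (negMulLog (∫ x in g ⁻¹' {c}, kronProb μ T β A (T w x) ∂μ) +
          (∫ x in g ⁻¹' {c}, kronProb μ T β A (T w x) ∂μ) * log (μ.real (g ⁻¹' {c}))) := by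
      have h2 : ∀ A ∈ α, negMulLog (μ.real (g ⁻¹' {c} ∩ T w ⁻¹' A)) =
          negMulLog (∫ x in g ⁻¹' {c}, kronProb μ T β A (T w x) ∂μ) := fun A hA => by
        rw [measureReal_inter_preimage_eq hT hU (hα.1 A hA) (hg c)]
      have h3 : negMulLog (μ.real (g ⁻¹' {c})) =
          -μ.real (g ⁻¹' {c}) * log (μ.real (g ⁻¹' {c})) := rfl
      rw [Finset.sum_add_distrib, ← Finset.sum_mul, sum_setIntegral_kronProb_comp hT hα,
        Finset.sum_congr rfl h2, h3]
      ring
    rw [h1]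
    refine Finset.sum_le_sum fun A hA => ?_
    refine (negMulLog_setIntegral_le (hqm A) (hq A hA) hM.le hη (v A c)).trans_eq ?_
    have h2 : ∫ x in g ⁻¹' {c}, |kronProb μ T β A (T w x) - v A c| ∂μ =
        ∫ x in g ⁻¹' {c}, |kronProb μ T β A (T w x) - v A (g x)| ∂μ :=
      setIntegral_congr_fun (hg' c) fun x hx => by
        simp only [mem_singleton_iff.1 (mem_preimage.1 hx)]
    rw [h2]
    simp
  refine (Finset.sum_le_sum fun c _ => hcell c).trans ?_
  rw [Finset.sum_comm, condEntAlg]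
  have hA : ∀ A ∈ α, ∑ c, (∫ x in g ⁻¹' {c}, negMulLog (kronProb μ T β A (T w x)) ∂μ +
        ε / (2 * n) * (∫ _ in g ⁻¹' {c}, 1 ∂μ) +
        2 * M * ∫ x in g ⁻¹' {c}, |kronProb μ T β A (T w x) - v A (g x)| ∂μ) ≤
      ∫ x, negMulLog (kronProb μ T β A x) ∂μ + ε / n := fun A hA => by
    rw [Finset.sum_add_distrib, Finset.sum_add_distrib, ← Finset.mul_sum, ← Finset.mul_sum,
      sum_setIntegral_preimage_singleton hg' (integrable_negMulLog (hqm A) (hq A hA)),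
      sum_setIntegral_preimage_singleton hg' (integrable_const 1),
      sum_setIntegral_preimage_singleton hg' (hvi A hA),
      integral_negMulLog_kronProb_comp hT w]
    have h3 := mul_le_mul_of_nonneg_left (hv A hA) (show 0 ≤ 2 * M by positivity)
    have h4 : ε / (2 * n) + 2 * M * (2 * δ) = ε / n := by
      rw [hδ]; field_simp; ring
    simp only [integral_const, probReal_univ, one_smul, mul_one]
    linarith
  refine (Finset.sum_le_sum hA).trans ?_
  rw [Finset.sum_add_distrib, Finset.sum_const, nsmul_eq_mul]
  have h5 : (α.card : ℝ) * (ε / n) ≤ ε := by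
    rw [mul_div_assoc', div_le_iff₀ hn0, hn]
    nlinarith
  exact add_le_add_right h5 _

end KroneckerEntropy

/-! ### Construction of the sequence -/

section SequenceEntropy

open Real

universe u

variable {X : Type u} [MeasurableSpace X] {μ : Measure X} {T : ℤ × ℤ → X → X} {β b : ℝ}
  {α : Finset (Set X)}

/-- A sequence with increasing first coordinates can be built by choosing its `k`-th term
according to the join of `α` along the earlier terms. -/
lemma exists_seq_of_forall_isPartition (hT : ∀ w, Measurable (T w)) (hα : IsPartition α)
    {R : ℕ → Finset (Set X) → ℤ × ℤ → Prop}
    (h : ∀ k P, IsPartition P → ∀ M : ℤ, ∃ w : ℤ × ℤ, M < w.1 ∧ R k P w) :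
    ∃ w : ℕ → ℤ × ℤ, StrictMono (fun i => (w i).1) ∧ ∀ k, R k (seqJoin T w α k) (w k) := by
  classical
  have h' : ∀ (k : ℕ) (P : Finset (Set X)) (M : ℤ), ∃ w : ℤ × ℤ, IsPartition P →
      M < w.1 ∧ R k P w := fun k P M => by
    by_cases hP : IsPartition P
    · exact (h k P hP M).imp fun w hw _ => hw
    · exact ⟨0, fun hP' => absurd hP' hP⟩
  choose next hnext using h'
  let st : ℕ → Finset (Set X) × ℤ := fun k => Nat.rec ({univ}, 0) (fun k s =>
    ((s.1 ×ˢ α).image fun p => p.1 ∩ T (next k s.1 s.2) ⁻¹' p.2, (next k s.1 s.2).1)) k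
  let w : ℕ → ℤ × ℤ := fun k => next k (st k).1 (st k).2
  have hst : ∀ k, seqJoin T w α k = (st k).1 := fun k => by
    induction k with
    | zero => rfl
    | succ k ih =>
      rw [seqJoin, ih]
  have hw : ∀ k, (st k).2 < (w k).1 ∧ R k (st k).1 (w k) := fun k =>
    hnext k _ _ (hst k ▸ isPartition_seqJoin hT hα k)
  exact ⟨w, strictMono_nat_of_lt_succ fun k => (hw (k + 1)).1, fun k => hst k ▸ (hw k).2⟩

lemma Lam_subset_Lam {b c : ℝ} (h : b ≤ c) : Lam β b ⊆ Lam β c := fun _ hp =>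
  ⟨by linarith [hp.1], by linarith [hp.2]⟩

/-- Sequences along which every join gains almost the conditional entropy of `α`. -/
lemma exists_seq_condEntAlg_sub_le [IsProbabilityMeasure μ]
    (hT : ∀ w, MeasurePreserving (T w) μ μ) (hU : IsRep (koopman hT)) (hα : IsPartition α)
    (hb : 0 < b) : ∃ w : ℕ → ℤ × ℤ, StrictMono (fun i => (w i).1) ∧ (∀ i, w i ∈ Lam β b) ∧
      ∀ k : ℕ, k * condEntAlg μ (dirKronAlg μ T β) α - 2 ≤ partEnt μ (seqJoin T w α k) := by
  obtain ⟨w, hw, h⟩ := exists_seq_of_forall_isPartition (R := fun k P w => w ∈ Lam β b ∧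
      condEntAlg μ (dirKronAlg μ T β) α - (1 / 2) ^ k ≤
        ∑ D ∈ P, ∑ A ∈ α, negMulLog (μ.real (D ∩ T w ⁻¹' A)) - partEnt μ P)
    (fun w => (hT w).measurable) hα fun k P hP M => by
      obtain ⟨w, hw, hM, h⟩ := exists_condEntAlg_sub_le hT hU hα hP M hb
        (show (0 : ℝ) < (1 / 2) ^ k by positivity)
      exact ⟨w, hM, hw, h⟩
  refine ⟨w, hw, fun i => (h i).1, fun k => ?_⟩
  have key : ∀ k : ℕ, k * condEntAlg μ (dirKronAlg μ T β) α - ∑ i ∈ Finset.range k, (1 / 2) ^ i ≤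
      partEnt μ (seqJoin T w α k) := fun k => by
    induction k with
    | zero => simp [seqJoin, partEnt]
    | succ k ih =>
      have h1 : partEnt μ (seqJoin T w α (k + 1)) =
          ∑ C ∈ seqJoin T w α k, ∑ A ∈ α, negMulLog (μ.real (C ∩ T (w k) ⁻¹' A)) :=
        sum_seqJoin_succ (fun w => (hT w).measurable) hα k (f := fun E => negMulLog (μ.real E))
          (by simp)
      rw [h1, Finset.sum_range_succ, Nat.cast_succ]
      linarith [(h k).2]
  linarith [key k, sum_geometric_two_le k]

lemma seqEnt_eq_of_bounds {w : ℕ → ℤ × ℤ} {h : ℝ}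
    (hl : ∃ C, ∀ k : ℕ, k * h - C ≤ partEnt μ (seqJoin T w α k))
    (hu : ∀ ε > 0, ∃ C, ∀ k : ℕ, partEnt μ (seqJoin T w α k) ≤ C + k * (h + ε)) :
    seqEnt μ T w α = h := by
  refine Tendsto.limsup_eq (tendsto_order.2 ⟨fun a ha => ?_, fun a ha => ?_⟩)
  · obtain ⟨C, hC⟩ := hl
    filter_upwards [eventually_gt_atTop 0, (tendsto_natCast_atTop_atTop (R := ℝ)).eventually_gt_atTop
      (C / (h - a))] with k hk hk'
    have hk0 : (0 : ℝ) < k := Nat.cast_pos.2 hk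
    rw [lt_div_iff₀ hk0]
    rw [div_lt_iff₀ (sub_pos.2 ha)] at hk'
    linarith [hC k]
  · obtain ⟨C, hC⟩ := hu ((a - h) / 2) (by linarith)
    filter_upwards [eventually_gt_atTop 0, (tendsto_natCast_atTop_atTop (R := ℝ)).eventually_gt_atTop
      (C / ((a - h) / 2))] with k hk hk'
    have hk0 : (0 : ℝ) < k := Nat.cast_pos.2 hk
    rw [div_lt_iff₀ hk0]
    rw [div_lt_iff₀ (by linarith)] at hk'
    linarith [hC k]

end SequenceEntropy

/-- there is an infinite subset of the strip, with strictly
monotone first coordinates, whose sequence entropy attains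
`H_μ(α | 𝒦^v_μ)`. -/
theorem exists_seqEnt_eq_condEnt_dirKron
    {X : Type*} [MetricSpace X] [CompactSpace X] [MeasurableSpace X] [BorelSpace X]
    (μ : Measure X) [IsProbabilityMeasure μ] (T : ℤ × ℤ → X → X)
    (hT : IsZ2MPS μ T) (β b : ℝ) (hb : 0 < b)
    (α : Finset (Set X)) (hα : IsPartition α) :
    ∃ w : ℕ → ℤ × ℤ, EnumIn w (Lam β b) ∧
      (StrictMono (fun i => (w i).1) ∨ StrictAnti (fun i => (w i).1)) ∧
      seqEnt μ T w α = condEntAlg μ (dirKronAlg μ T β) α := by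
  have hmp := hT.2.2.2
  have hU := isRep_koopman hmp hT.2.1 hT.2.2.1
  obtain ⟨w, hw, hwb, hl⟩ := exists_seq_condEntAlg_sub_le (β := β) hmp hU hα
    (lt_min hb one_pos)
  refine ⟨w, ⟨fun i j hij => hw.injective (congrArg Prod.fst hij),
    fun i => Lam_subset_Lam (min_le_left _ _) (hwb i)⟩, Or.inl hw,
    seqEnt_eq_of_bounds ⟨2, hl⟩ fun ε hε => ?_⟩
  obtain ⟨κ, _, g, hg, hs⟩ := exists_le_condEntAlg_add (β := β) hmp hU hα hε
  exact ⟨_, partEnt_seqJoin_le_s2 (fun w => (hmp w).measurable) hα hg fun i =>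
    hs _ (Lam_subset_Lam (min_le_right _ _) (hwb i))⟩

end Directional
end
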